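/- For the family of all graphs over an alphabet Σ with {0,1} ⊆ Σ, and for every k ≥ 1, the inclusion DPTWA^k ⊆ FO+DTC^k is strict: the language L₀ of all graphs in which every node has label 0 is definable in first-order logic (hence in FO+DTC^k) but is not accepted by any deterministic k-head graph-walking automaton with nested pebbles (even with jump instructions). Consequently also the inclusion ⋃_k DPTWA^k ⊆ ⋃_k FO+DTC^k is strict. -/

import Mathlib

namespace NestedPebblesGraphs

/-- A nonempty finite weakly connected directed graph with node and edge labels
from `Sig`, such that no node has two outgoing edges with the same label, nor two
incoming edges with the same label. -/
structure LGraph (Sig : Type) : Type 1 where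
  V : Type
  finV : Fintype V
  neV : Nonempty V
  nlab : V → Sig
  edge : Sig → V → V → Prop
  out_unique : ∀ a u v v', edge a u v → edge a u v' → v = v'
  in_unique : ∀ a u u' v, edge a u v → edge a u' v → u = u'
  conn : ∀ u v : V,
    Relation.ReflTransGen (fun x y => (∃ a, edge a x y) ∨ (∃ a, edge a y x)) u v

variable {Sig : Type}

/-!  ### First-order logic with k-ary transitive closure, on graphs  -/

/-- First-order formulas on graphs over `Sig`, with a `k`-ary transitive closure
operator.  `lab a x` means node `x` has label `a`; `edg a x y` means there is an
`a`-labelled edge from `x` to `y`; `tc xs ys φ us vs` is the transitive closure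
`φ*` of `φ` with respect to the tuples of variables `xs`, `ys` (which it binds),
applied to the tuples of variables `us`, `vs`. -/
inductive GForm (Sig : Type) (k : ℕ) : Type
  | lab (a : Sig) (x : ℕ)
  | edg (a : Sig) (x y : ℕ)
  | eq (x y : ℕ)
  | not (φ : GForm Sig k)
  | and (φ ψ : GForm Sig k)
  | or (φ ψ : GForm Sig k)
  | ex (x : ℕ) (φ : GForm Sig k)
  | all (x : ℕ) (φ : GForm Sig k)
  | tc (xs ys : Fin k → ℕ) (φ : GForm Sig k) (us vs : Fin k → ℕ)

/-- Update a valuation on a tuple of variables simultaneously. -/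
noncomputable def updVec {α : Type} {k : ℕ} (ν : ℕ → α) (xs : Fin k → ℕ) (a : Fin k → α) :
    ℕ → α :=
  fun n => if h : ∃ i, xs i = n then a h.choose else ν n

/-- Satisfaction of a formula in a graph `g` under a valuation of the variables. -/
def GSat {k : ℕ} (g : LGraph Sig) : GForm Sig k → (ℕ → g.V) → Prop
  | .lab a x, ν => g.nlab (ν x) = a
  | .edg a x y, ν => g.edge a (ν x) (ν y)
  | .eq x y, ν => ν x = ν y
  | .not φ, ν => ¬ GSat g φ ν
  | .and φ ψ, ν => GSat g φ ν ∧ GSat g ψ ν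
  | .or φ ψ, ν => GSat g φ ν ∨ GSat g ψ ν
  | .ex x φ, ν => ∃ u : g.V, GSat g φ (Function.update ν x u)
  | .all x φ, ν => ∀ u : g.V, GSat g φ (Function.update ν x u)
  | .tc xs ys φ us vs, ν =>
      Relation.ReflTransGen
        (fun a b : Fin k → g.V => GSat g φ (updVec (updVec ν xs a) ys b))
        (fun i => ν (us i)) (fun i => ν (vs i))

/-- The free variables of a formula. -/
def gfree {k : ℕ} : GForm Sig k → Set ℕ
  | .lab _ x => {x}
  | .edg _ x y => {x, y}
  | .eq x y => {x, y}
  | .not φ => gfree φ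
  | .and φ ψ => gfree φ ∪ gfree ψ
  | .or φ ψ => gfree φ ∪ gfree ψ
  | .ex x φ => gfree φ \ {x}
  | .all x φ => gfree φ \ {x}
  | .tc xs ys φ us vs =>
      (gfree φ \ (Set.range xs ∪ Set.range ys)) ∪ Set.range us ∪ Set.range vs

/-- Two `k`-tuples of variables consist of `2k` pairwise distinct variables. -/
def Distinct2 {k : ℕ} (xs ys : Fin k → ℕ) : Prop :=
  Function.Injective xs ∧ Function.Injective ys ∧ ∀ i j, xs i ≠ ys j

/-- `φ` is functional in the tuples of variables `xs`, `ys`. -/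
def GFunctionalIn {k : ℕ} (φ : GForm Sig k) (xs ys : Fin k → ℕ) : Prop :=
  ∀ (g : LGraph Sig) (ν : ℕ → g.V) (a b b' : Fin k → g.V),
    GSat g φ (updVec (updVec ν xs a) ys b) →
    GSat g φ (updVec (updVec ν xs a) ys b') → b = b'

/-- Well-formedness: in each transitive closure the `2k` bound variables are
pairwise distinct and occur free in the body. -/
def GWF {k : ℕ} : GForm Sig k → Prop
  | .not φ => GWF φ
  | .and φ ψ => GWF φ ∧ GWF ψ
  | .or φ ψ => GWF φ ∧ GWF ψ
  | .ex _ φ => GWF φ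
  | .all _ φ => GWF φ
  | .tc xs ys φ _ _ =>
      Distinct2 xs ys ∧ (Set.range xs ∪ Set.range ys) ⊆ gfree φ ∧ GWF φ
  | _ => True

/-- All transitive closures occurring in the formula are deterministic. -/
def GDetTC {k : ℕ} : GForm Sig k → Prop
  | .not φ => GDetTC φ
  | .and φ ψ => GDetTC φ ∧ GDetTC ψ
  | .or φ ψ => GDetTC φ ∧ GDetTC ψ
  | .ex _ φ => GDetTC φ
  | .all _ φ => GDetTC φ
  | .tc xs ys φ _ _ => GFunctionalIn φ xs ys ∧ GDetTC φ
  | _ => True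

/-- All occurrences of transitive closure are positive. -/
def GPosTC {k : ℕ} : Bool → GForm Sig k → Prop
  | b, .not φ => GPosTC (!b) φ
  | b, .and φ ψ => GPosTC b φ ∧ GPosTC b ψ
  | b, .or φ ψ => GPosTC b φ ∧ GPosTC b ψ
  | b, .ex _ φ => GPosTC b φ
  | b, .all _ φ => GPosTC b φ
  | b, .tc _ _ φ _ _ => b = true ∧ GPosTC b φ
  | _, _ => True

/-- The formula contains no transitive closure operator (pure first-order). -/
def GTCFree {k : ℕ} : GForm Sig k → Prop
  | .not φ => GTCFree φ
  | .and φ ψ => GTCFree φ ∧ GTCFree ψ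
  | .or φ ψ => GTCFree φ ∧ GTCFree ψ
  | .ex _ φ => GTCFree φ
  | .all _ φ => GTCFree φ
  | .tc _ _ _ _ _ => False
  | _ => True

/-- `FO+DTC^k` graph languages within the family `F`: those defined by closed
formulas with deterministic `k`-ary transitive closure. -/
def FODTCg (Sig : Type) (F : Set (LGraph Sig)) (k : ℕ) : Set (Set (LGraph Sig)) :=
  {L | ∃ φ : GForm Sig k, GWF φ ∧ GDetTC φ ∧ gfree φ = ∅ ∧
        L = {g | g ∈ F ∧ ∀ ν : ℕ → g.V, GSat g φ ν}}

/-- `FO+posTC^k` graph languages within the family `F`. -/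
def FOposTCg (Sig : Type) (F : Set (LGraph Sig)) (k : ℕ) : Set (Set (LGraph Sig)) :=
  {L | ∃ φ : GForm Sig k, GWF φ ∧ GPosTC true φ ∧ gfree φ = ∅ ∧
        L = {g | g ∈ F ∧ ∀ ν : ℕ → g.V, GSat g φ ν}}

/-!  ### k-head graph-walking automata with nested pebbles  -/

/-- Tests of a `k`-head graph-walking automaton with pebble set `X`. -/
inductive GTest (Sig : Type) (k : ℕ) (X : Type) : Type
  | lab (i : Fin k) (a : Sig)
  | inedge (i : Fin k) (a : Sig)
  | outedge (i : Fin k) (a : Sig)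
  | peb (i : Fin k) (x : X)

/-- Instructions: move head `i` along an incoming or outgoing `a`-labelled edge,
drop a pebble at head `i`, retrieve the most recently dropped pebble (from a
distance), jump head `i` to the node holding pebble `x`, or perform a positive
(`b = true`) or negated (`b = false`) test. -/
inductive GInstr (Sig : Type) (k : ℕ) (X : Type) : Type
  | inmove (i : Fin k) (a : Sig)
  | outmove (i : Fin k) (a : Sig)
  | dropPeb (i : Fin k) (x : X)
  | retrieve (x : X)
  | jump (i : Fin k) (x : X)
  | test (b : Bool) (τ : GTest Sig k X)

/-- A `k`-head graph-walking automaton with nested pebbles. -/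
structure GWA (Sig : Type) (k : ℕ) : Type 1 where
  Q : Type
  finQ : Fintype Q
  X : Type
  finX : Fintype X
  q0 : Q
  acc : Set Q
  instr : Set (Q × GInstr Sig k X × Q)
  instrFin : instr.Finite

/-- Configurations: a state, the positions of the `k` heads, and the stack of
dropped pebbles with their positions (most recent first). -/
abbrev GConf {k : ℕ} (A : GWA Sig k) (g : LGraph Sig) : Type :=
  A.Q × (Fin k → g.V) × List (A.X × g.V)

/-- Semantics of tests. -/
def gTestHolds {k : ℕ} (g : LGraph Sig) {X : Type} (τ : GTest Sig k X)
    (hs : Fin k → g.V) (π : List (X × g.V)) : Prop :=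
  match τ with
  | .lab i a => g.nlab (hs i) = a
  | .inedge i a => ∃ u, g.edge a u (hs i)
  | .outedge i a => ∃ v, g.edge a (hs i) v
  | .peb i x => (x, hs i) ∈ π

/-- Semantics of a single instruction. -/
def gInstrStep {k : ℕ} (g : LGraph Sig) {X : Type} (ins : GInstr Sig k X)
    (hs : Fin k → g.V) (π : List (X × g.V))
    (hs' : Fin k → g.V) (π' : List (X × g.V)) : Prop :=
  match ins with
  | .inmove i a => π' = π ∧ g.edge a (hs' i) (hs i) ∧ ∀ h, h ≠ i → hs' h = hs h
  | .outmove i a => π' = π ∧ g.edge a (hs i) (hs' i) ∧ ∀ h, h ≠ i → hs' h = hs h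
  | .dropPeb i x => hs' = hs ∧ π' = (x, hs i) :: π ∧ ∀ w, (x, w) ∉ π
  | .retrieve x => hs' = hs ∧ ∃ w, π = (x, w) :: π'
  | .jump i x => π' = π ∧ (x, hs' i) ∈ π ∧ ∀ h, h ≠ i → hs' h = hs h
  | .test b τ => hs' = hs ∧ π' = π ∧ (gTestHolds g τ hs π ↔ b = true)

/-- The step relation of automaton `A` on graph `g`. -/
def GStep {k : ℕ} (A : GWA Sig k) (g : LGraph Sig) : GConf A g → GConf A g → Prop :=
  fun c c' => ∃ ins : GInstr Sig k A.X,
    (c.1, ins, c'.1) ∈ A.instr ∧ gInstrStep g ins c.2.1 c.2.2 c'.2.1 c'.2.2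

/-- `χ'` is the negation of the test `χ`. -/
def gNegOf {k : ℕ} {X : Type} (χ χ' : GInstr Sig k X) : Prop :=
  ∃ b τ, χ = GInstr.test b τ ∧ χ' = GInstr.test (!b) τ

/-- Determinism: any two distinct instructions with the same source state consist
of a test and its negation. -/
def GDeterministic {k : ℕ} (A : GWA Sig k) : Prop :=
  ∀ p χ₁ q₁ χ₂ q₂, (p, χ₁, q₁) ∈ A.instr → (p, χ₂, q₂) ∈ A.instr →
    (χ₁, q₁) ≠ (χ₂, q₂) → gNegOf χ₁ χ₂ ∨ gNegOf χ₂ χ₁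

/-- A configuration is halting if no step is possible from it. -/
def GHaltingConf {k : ℕ} (A : GWA Sig k) (g : LGraph Sig) (c : GConf A g) : Prop :=
  ∀ c', ¬ GStep A g c c'

/-- There is an accepting computation started with all heads on node `u`:
it starts in the initial state with no pebbles, and halts in an accepting state
with no pebbles on the graph. -/
def AccFrom {k : ℕ} (A : GWA Sig k) (g : LGraph Sig) (u : g.V) : Prop :=
  ∃ (q : A.Q) (hs : Fin k → g.V), q ∈ A.acc ∧
    Relation.ReflTransGen (GStep A g) (A.q0, fun _ => u, []) (q, hs, []) ∧
    GHaltingConf A g (q, hs, [])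

/-- `A` accepts `g`: for every choice of initial node there is an accepting
computation. -/
def GAccepts {k : ℕ} (A : GWA Sig k) (g : LGraph Sig) : Prop :=
  ∀ u : g.V, AccFrom A g u

/-- The restriction on automata: acceptance is independent of the initial node. -/
def NodeIndependent {k : ℕ} (A : GWA Sig k) : Prop :=
  ∀ (g : LGraph Sig) (u₁ u₂ : g.V), AccFrom A g u₁ → AccFrom A g u₂

/-- The automaton uses no jump instructions (the basic model). -/
def NoJump {k : ℕ} (A : GWA Sig k) : Prop :=
  ∀ p χ q, (p, χ, q) ∈ A.instr → ∀ i x, χ ≠ GInstr.jump i x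

/-- `DPTWA^k` within the family `F`: graph languages accepted by deterministic
`k`-head graph-walking automata with nested pebbles (no jump instructions). -/
def DPTWAg (Sig : Type) (F : Set (LGraph Sig)) (k : ℕ) : Set (Set (LGraph Sig)) :=
  {L | ∃ A : GWA Sig k, GDeterministic A ∧ NoJump A ∧ NodeIndependent A ∧
        L = {g | g ∈ F ∧ GAccepts A g}}

/-- `DPTWA^k` within the family `F`, for the model extended with jump
instructions. -/
def DPTWAgJ (Sig : Type) (F : Set (LGraph Sig)) (k : ℕ) : Set (Set (LGraph Sig)) :=
  {L | ∃ A : GWA Sig k, GDeterministic A ∧ NodeIndependent A ∧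
        L = {g | g ∈ F ∧ GAccepts A g}}

/-- `NPTWA^k` within the family `F`: graph languages accepted by nondeterministic
`k`-head graph-walking automata with nested pebbles (no jump instructions). -/
def NPTWAg (Sig : Type) (F : Set (LGraph Sig)) (k : ℕ) : Set (Set (LGraph Sig)) :=
  {L | ∃ A : GWA Sig k, NoJump A ∧ NodeIndependent A ∧
        L = {g | g ∈ F ∧ GAccepts A g}}

/-- Started with all heads on node `u` of `g`, the (deterministic) automaton `A`
performs a walk that halts and during which every node of `g` is visited by some
head at least once. -/
def SearchesFrom {k : ℕ} (A : GWA Sig k) (g : LGraph Sig) (u : g.V) : Prop :=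
  ∃ (n : ℕ) (cs : Fin (n + 1) → GConf A g),
    cs 0 = (A.q0, fun _ => u, []) ∧
    (∀ i : Fin n, GStep A g (cs i.castSucc) (cs i.succ)) ∧
    GHaltingConf A g (cs (Fin.last n)) ∧
    ∀ v : g.V, ∃ (i : Fin (n + 1)) (h : Fin k), (cs i).2.1 h = v

/-- A family of graphs is `k`-searchable if some fixed deterministic `k`-head
graph-walking automaton with nested pebbles (a guide) traverses every graph of the
family from every initial node, visiting all nodes and halting. -/
def kSearchable (Sig : Type) (F : Set (LGraph Sig)) (k : ℕ) : Prop :=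
  ∃ A : GWA Sig k, GDeterministic A ∧ NoJump A ∧
    ∀ g ∈ F, ∀ u : g.V, SearchesFrom A g u

/-- A family of graphs is searchable if it is `1`-searchable, i.e., some fixed
single-head deterministic graph-walking automaton with nested pebbles traverses
every graph of the family. -/
def Searchable (Sig : Type) (F : Set (LGraph Sig)) : Prop :=
  kSearchable Sig F 1

/-- Replacing the node labels of a graph. -/
def relabel (g : LGraph Sig) (f : g.V → Sig) : LGraph Sig :=
  { g with nlab := f }

/-- Membership in the family does not depend on the node labels. -/
def NodeLabelInsensitive (F : Set (LGraph Sig)) : Prop :=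
  ∀ g ∈ F, ∀ f : g.V → Sig, relabel g f ∈ F

end NestedPebblesGraphs


namespace NestedPebblesGraphs

section Definability

variable {Sig : Type} {k : ℕ}

/-- Definability of a family of relations on nodes with context `C`: for every
naming of the context there is a suitable formula. -/
def Dfn (k : ℕ) {C : Type} (R : ∀ g : LGraph Sig, (C → g.V) → Prop) : Prop :=
  ∀ e : C → ℕ, ∃ φ : GForm Sig k, GWF φ ∧ GDetTC φ ∧
    ∀ (g : LGraph Sig) (ν : ℕ → g.V), GSat g φ ν ↔ R g (fun c => ν (e c))

variable {C C' D : Type}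

theorem Dfn.congr {R R' : ∀ g : LGraph Sig, (C → g.V) → Prop} (h : Dfn k R)
    (hh : ∀ g c, R' g c ↔ R g c) : Dfn k R' := by
  intro e
  obtain ⟨φ, h1, h2, h3⟩ := h e
  exact ⟨φ, h1, h2, fun g ν => (h3 g ν).trans (hh _ _).symm⟩

theorem Dfn.lab (a : Sig) (x : C) : Dfn k (fun (g : LGraph Sig) c => g.nlab (c x) = a) :=
  fun e => ⟨.lab a (e x), trivial, trivial, fun _ _ => Iff.rfl⟩

theorem Dfn.edg (a : Sig) (x y : C) :
    Dfn k (fun (g : LGraph Sig) c => g.edge a (c x) (c y)) :=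
  fun e => ⟨.edg a (e x) (e y), trivial, trivial, fun _ _ => Iff.rfl⟩

theorem Dfn.eq (x y : C) : Dfn k (fun (g : LGraph Sig) (c : C → g.V) => c x = c y) :=
  fun e => ⟨.eq (e x) (e y), trivial, trivial, fun _ _ => Iff.rfl⟩

theorem Dfn.not {R : ∀ g : LGraph Sig, (C → g.V) → Prop} (h : Dfn k R) :
    Dfn k (fun g c => ¬ R g c) := by
  intro e
  obtain ⟨φ, h1, h2, h3⟩ := h e
  exact ⟨.not φ, h1, h2, fun g ν => not_congr (h3 g ν)⟩

theorem Dfn.and {R R' : ∀ g : LGraph Sig, (C → g.V) → Prop} (h : Dfn k R) (h' : Dfn k R') :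
    Dfn k (fun g c => R g c ∧ R' g c) := by
  intro e
  obtain ⟨φ, h1, h2, h3⟩ := h e
  obtain ⟨φ', h1', h2', h3'⟩ := h' e
  exact ⟨.and φ φ', ⟨h1, h1'⟩, ⟨h2, h2'⟩, fun g ν => and_congr (h3 g ν) (h3' g ν)⟩

theorem Dfn.or {R R' : ∀ g : LGraph Sig, (C → g.V) → Prop} (h : Dfn k R) (h' : Dfn k R') :
    Dfn k (fun g c => R g c ∨ R' g c) := by
  intro e
  obtain ⟨φ, h1, h2, h3⟩ := h e
  obtain ⟨φ', h1', h2', h3'⟩ := h' e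
  exact ⟨.or φ φ', ⟨h1, h1'⟩, ⟨h2, h2'⟩, fun g ν => or_congr (h3 g ν) (h3' g ν)⟩

theorem Dfn.const (P : Prop) : Dfn k (fun (g : LGraph Sig) (_ : C → g.V) => P) := by
  by_cases hP : P
  · exact fun e => ⟨.eq 0 0, trivial, trivial, fun g ν => by simp [GSat, hP]⟩
  · exact fun e => ⟨.not (.eq 0 0), trivial, trivial, fun g ν => by simp [GSat, hP]⟩

theorem Dfn.reindex {R : ∀ g : LGraph Sig, (C → g.V) → Prop} (h : Dfn k R) (ρ : C → C') :
    Dfn k (fun g c => R g (fun x => c (ρ x))) :=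
  fun e => h (fun x => e (ρ x))

theorem Dfn.exists_mem {ι : Type} {s : Set ι} (hs : s.Finite)
    {R : ι → ∀ g : LGraph Sig, (C → g.V) → Prop} (h : ∀ i, Dfn k (R i)) :
    Dfn k (fun g c => ∃ i ∈ s, R i g c) := by
  induction s, hs using Set.Finite.induction_on with
  | empty => exact (Dfn.const False).congr (by simp)
  | @insert a s _ _ ih => exact ((h a).or ih).congr (by simp)

theorem Dfn.exists_fin {ι : Type} [Finite ι]
    {R : ι → ∀ g : LGraph Sig, (C → g.V) → Prop} (h : ∀ i, Dfn k (R i)) :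
    Dfn k (fun g c => ∃ i, R i g c) :=
  (Dfn.exists_mem (Set.finite_univ) h).congr (by simp)

theorem Dfn.forall_fin {ι : Type} [Finite ι]
    {R : ι → ∀ g : LGraph Sig, (C → g.V) → Prop} (h : ∀ i, Dfn k (R i)) :
    Dfn k (fun g c => ∀ i, R i g c) :=
  (Dfn.exists_fin (fun i => (h i).not)).not.congr (by simp)

/-- Iterated existential quantification. -/
def exs (φ : GForm Sig k) : List ℕ → GForm Sig k
  | [] => φ
  | x :: l => .ex x (exs φ l)

theorem exs_wf (φ : GForm Sig k) (l : List ℕ) (h : GWF φ) : GWF (exs φ l) := by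
  induction l with
  | nil => exact h
  | cons x l ih => exact ih

theorem exs_det (φ : GForm Sig k) (l : List ℕ) (h : GDetTC φ) : GDetTC (exs φ l) := by
  induction l with
  | nil => exact h
  | cons x l ih => exact ih

theorem exs_sat (φ : GForm Sig k) (l : List ℕ) (g : LGraph Sig) (ν : ℕ → g.V) :
    GSat g (exs φ l) ν ↔ ∃ ν' : ℕ → g.V, (∀ n, n ∉ l → ν' n = ν n) ∧ GSat g φ ν' := by
  induction l generalizing ν with
  | nil =>
    constructor
    · exact fun h => ⟨ν, fun _ _ => rfl, h⟩
    · rintro ⟨ν', h, h'⟩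
      have : ν' = ν := funext fun n => h n (by simp)
      exact this ▸ h'
  | cons x l ih =>
    constructor
    · rintro ⟨u, hu⟩
      obtain ⟨ν', h1, h2⟩ := (ih _).1 hu
      refine ⟨ν', fun n hn => ?_, h2⟩
      simp only [List.mem_cons, not_or] at hn
      rw [h1 n hn.2, Function.update_of_ne hn.1]
    · rintro ⟨ν', h1, h2⟩
      refine ⟨ν' x, (ih _).2 ⟨ν', fun n hn => ?_, h2⟩⟩
      by_cases hx : n = x
      · subst hx; simp
      · rw [Function.update_of_ne hx]; exact h1 n (by simp [hx, hn])

theorem fresh_names [Finite D] (U : Set ℕ) (hU : U.Finite) :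
    ∃ f : D → ℕ, Function.Injective f ∧ ∀ d, f d ∉ U := by
  obtain ⟨N, hN⟩ := hU.bddAbove
  obtain ⟨n, ⟨eq⟩⟩ := Finite.exists_equiv_fin D
  refine ⟨fun d => N + 1 + (eq d : ℕ), fun a b h => ?_, fun d hd => ?_⟩
  · apply eq.injective; apply Fin.ext; simpa using h
  · have h1 : N + 1 + (eq d : ℕ) ≤ N := hN hd
    omega

theorem Dfn.ex [Finite C] [Finite D] {R : ∀ g : LGraph Sig, (C ⊕ D → g.V) → Prop}
    (h : Dfn k R) : Dfn k (fun g c => ∃ d : D → g.V, R g (Sum.elim c d)) := by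
  classical
  intro e
  obtain ⟨f, hf, hfe⟩ := fresh_names (D := D) (Set.range e) (Set.finite_range e)
  obtain ⟨φ, h1, h2, h3⟩ := h (Sum.elim e f)
  have hfin : (Set.range f).Finite := Set.finite_range f
  refine ⟨exs φ hfin.toFinset.toList, exs_wf _ _ h1, exs_det _ _ h2, fun g ν => ?_⟩
  rw [exs_sat]
  simp only [Finset.mem_toList, Set.Finite.mem_toFinset, h3]
  constructor
  · rintro ⟨ν', h4, h5⟩
    refine ⟨fun d => ν' (f d), ?_⟩
    convert h5 using 1
    funext c
    rcases c with c | d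
    · simp only [Sum.elim_inl]
      exact (h4 _ (fun ⟨d, hd⟩ => hfe d ⟨c, hd.symm⟩)).symm
    · simp
  · rintro ⟨d, hd⟩
    refine ⟨fun n => if hn : ∃ x, f x = n then d hn.choose else ν n, fun n hn => ?_, ?_⟩
    · exact dif_neg hn
    · convert hd using 1
      funext c
      rcases c with c | x
      · simp only [Sum.elim_inl]
        exact dif_neg (fun ⟨y, hy⟩ => hfe y ⟨c, hy.symm⟩)
      · simp only [Sum.elim_inr]
        have hx : ∃ y, f y = f x := ⟨x, rfl⟩
        exact (dif_pos hx).trans (congrArg d (hf hx.choose_spec))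

theorem Dfn.ex1 [Finite C] {R : ∀ g : LGraph Sig, (C ⊕ Unit → g.V) → Prop}
    (h : Dfn k R) : Dfn k (fun g c => ∃ u : g.V, R g (Sum.elim c (fun _ => u))) :=
  h.ex.congr (fun _ _ => ⟨fun ⟨u, hu⟩ => ⟨fun _ => u, hu⟩, fun ⟨d, hd⟩ => ⟨d (), hd⟩⟩)

theorem updVec_apply {α : Type} (ν : ℕ → α) (xs : Fin k → ℕ) (hx : Function.Injective xs)
    (a : Fin k → α) (i : Fin k) : updVec ν xs a (xs i) = a i := by
  have h : ∃ j, xs j = xs i := ⟨i, rfl⟩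
  unfold updVec
  rw [dif_pos h, hx h.choose_spec]

theorem updVec_ne {α : Type} (ν : ℕ → α) (xs : Fin k → ℕ)
    (a : Fin k → α) (n : ℕ) (hn : ∀ i, xs i ≠ n) : updVec ν xs a n = ν n := by
  unfold updVec
  rw [dif_neg]; rintro ⟨i, hi⟩; exact hn i hi

/-- Conjunction with trivial equations, making variables free. -/
def addEqs (φ : GForm Sig k) : List ℕ → GForm Sig k
  | [] => φ
  | x :: l => .and (.eq x x) (addEqs φ l)

theorem addEqs_wf (φ : GForm Sig k) (l : List ℕ) (h : GWF φ) : GWF (addEqs φ l) := by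
  induction l with
  | nil => exact h
  | cons x l ih => exact ⟨trivial, ih⟩

theorem addEqs_det (φ : GForm Sig k) (l : List ℕ) (h : GDetTC φ) : GDetTC (addEqs φ l) := by
  induction l with
  | nil => exact h
  | cons x l ih => exact ⟨trivial, ih⟩

theorem addEqs_sat (φ : GForm Sig k) (l : List ℕ) (g : LGraph Sig) (ν : ℕ → g.V) :
    GSat g (addEqs φ l) ν ↔ GSat g φ ν := by
  induction l with
  | nil => exact Iff.rfl
  | cons x l ih => exact (and_iff_right rfl).trans ih

theorem addEqs_free (φ : GForm Sig k) (l : List ℕ) (x : ℕ) (hx : x ∈ l) :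
    x ∈ gfree (addEqs φ l) := by
  induction l with
  | nil => simp at hx
  | cons y l ih =>
    rcases List.mem_cons.1 hx with rfl | h
    · left; simp [gfree]
    · right; exact ih h

/-- Relations between `k`-tuples with parameters in `C`. -/
def Dfn2 (k : ℕ) {C : Type} (R : ∀ g : LGraph Sig, (C → g.V) → (Fin k → g.V) → (Fin k → g.V) → Prop) :
    Prop :=
  Dfn k (C := C ⊕ (Fin k ⊕ Fin k)) (fun g c =>
    R g (fun x => c (.inl x)) (fun i => c (.inr (.inl i))) (fun i => c (.inr (.inr i))))

theorem Dfn2.tc [Finite C]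
    {R : ∀ g : LGraph Sig, (C → g.V) → (Fin k → g.V) → (Fin k → g.V) → Prop}
    (h : Dfn2 k R) (hf : ∀ g c a b b', R g c a b → R g c a b' → b = b') :
    Dfn2 k (fun g c a b => Relation.ReflTransGen (R g c) a b) := by
  intro e
  obtain ⟨f, hfi, hfe⟩ := fresh_names (D := Fin k ⊕ Fin k) (Set.range e) (Set.finite_range e)
  obtain ⟨φ, h1, h2, h3⟩ := h (Sum.elim (fun x => e (.inl x)) f)
  set xs : Fin k → ℕ := fun i => f (.inl i) with hxs
  set ys : Fin k → ℕ := fun i => f (.inr i) with hys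
  have hxi : Function.Injective xs := fun i j hij => by simpa using hfi hij
  have hyi : Function.Injective ys := fun i j hij => by simpa using hfi hij
  have hxy : ∀ i j, xs i ≠ ys j := fun i j hij => by simpa using hfi hij
  have key : ∀ (g : LGraph Sig) (ν : ℕ → g.V) (a b : Fin k → g.V),
      GSat g φ (updVec (updVec ν xs a) ys b) ↔ R g (fun x => ν (e (.inl x))) a b := by
    intro g ν a b
    rw [h3]
    have e1 : (fun x => updVec (updVec ν xs a) ys b (e (.inl x))) = fun x => ν (e (.inl x)) := by
      funext x
      rw [updVec_ne _ _ _ _ (fun i hi => hfe _ ⟨_, hi.symm⟩),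
        updVec_ne _ _ _ _ (fun i hi => hfe _ ⟨_, hi.symm⟩)]
    have e2 : (fun i => updVec (updVec ν xs a) ys b (xs i)) = a := by
      funext i
      rw [updVec_ne _ _ _ _ (fun j hj => hxy _ _ hj.symm), updVec_apply _ _ hxi]
    have e3 : (fun i => updVec (updVec ν xs a) ys b (ys i)) = b := by
      funext i
      rw [updVec_apply _ _ hyi]
    simp only [Sum.elim_inl, Sum.elim_inr, e1]
    rw [e2, e3]
  have hfin : (Set.range f).Finite := Set.finite_range f
  refine ⟨.tc xs ys (addEqs φ hfin.toFinset.toList) (fun i => e (.inr (.inl i)))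
    (fun i => e (.inr (.inr i))), ⟨⟨hxi, hyi, hxy⟩, ?_, addEqs_wf _ _ h1⟩,
    ⟨?_, addEqs_det _ _ h2⟩, ?_⟩
  · rintro n (⟨i, rfl⟩ | ⟨i, rfl⟩) <;> apply addEqs_free <;> simp [hxs, hys]
  · intro g ν a b b' hb hb'
    rw [addEqs_sat, key] at hb hb'
    exact hf _ _ _ _ _ hb hb'
  · intro g ν
    simp only [GSat, addEqs_sat, key]

theorem gfree_finite (φ : GForm Sig k) : (gfree φ).Finite := by
  induction φ with
  | lab a x => exact Set.finite_singleton _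
  | edg a x y => exact (Set.finite_singleton _).insert _
  | eq x y => exact (Set.finite_singleton _).insert _
  | not φ ih => exact ih
  | and φ ψ ih ih' => exact ih.union ih'
  | or φ ψ ih ih' => exact ih.union ih'
  | ex x φ ih => exact ih.sdiff
  | all x φ ih => exact ih.sdiff
  | tc xs ys φ us vs ih =>
    exact (ih.sdiff.union (Set.finite_range _)).union (Set.finite_range _)

theorem close_formula (φ : GForm Sig k) (h1 : GWF φ) (h2 : GDetTC φ) :
    ∃ ψ : GForm Sig k, GWF ψ ∧ GDetTC ψ ∧ gfree ψ = ∅ ∧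
      ∀ g : LGraph Sig, (∀ ν, GSat g ψ ν) ↔ ∀ ν, GSat g φ ν := by
  have : ∀ (n : ℕ) (φ : GForm Sig k), GWF φ → GDetTC φ → (gfree φ).ncard = n →
    ∃ ψ : GForm Sig k, GWF ψ ∧ GDetTC ψ ∧ gfree ψ = ∅ ∧
      ∀ g : LGraph Sig, (∀ ν, GSat g ψ ν) ↔ ∀ ν, GSat g φ ν := by
    intro n
    induction n with
    | zero =>
      intro φ h1 h2 h
      exact ⟨φ, h1, h2, (Set.ncard_eq_zero (gfree_finite φ)).1 h, fun _ => Iff.rfl⟩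
    | succ n ih =>
      intro φ h1 h2 h
      obtain ⟨x, hx⟩ := Set.nonempty_of_ncard_ne_zero (s := gfree φ) (by omega)
      obtain ⟨ψ, p1, p2, p3, p4⟩ := ih (.all x φ) h1 h2 (by
        have := Set.ncard_sdiff_singleton_add_one hx (gfree_finite φ)
        simp only [gfree]; omega)
      refine ⟨ψ, p1, p2, p3, fun g => (p4 g).trans ⟨fun hh ν => ?_, fun hh ν u => hh _⟩⟩
      have := hh ν (ν x)
      rwa [Function.update_eq_self] at this
  exact this _ φ h1 h2 rfl

theorem Dfn.language {P : LGraph Sig → Prop}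
    (h : Dfn k (C := Empty) (fun g _ => P g)) :
    {g | P g} ∈ FODTCg Sig Set.univ k := by
  obtain ⟨φ, h1, h2, h3⟩ := h (fun x => x.elim)
  obtain ⟨ψ, p1, p2, p3, p4⟩ := close_formula φ h1 h2
  refine ⟨ψ, p1, p2, p3, ?_⟩
  ext g
  simp only [Set.mem_ofPred_eq, Set.mem_univ, true_and, p4, h3]
  have := g.neV
  simp

end Definability

end NestedPebblesGraphs


namespace NestedPebblesGraphs

section Kleene

variable {Q α : Type}

/-- Kleene's construction: paths whose intermediate states lie in a list. -/
def kle (S : Q → Q → α → α → Prop) : List Q → Q → Q → α → α → Prop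
  | [] => S
  | r :: R => fun p q a b => kle S R p q a b ∨
      ∃ u v, kle S R p r a u ∧ Relation.ReflTransGen (kle S R r r) u v ∧ kle S R r q v b

/-- The step relation on pairs associated with a matrix of relations. -/
def pairRel (S : Q → Q → α → α → Prop) : Q × α → Q × α → Prop :=
  fun c c' => S c.1 c'.1 c.2 c'.2

theorem det_rtg_unique {β : Type} {r : β → β → Prop} (hr : ∀ a b c, r a b → r a c → b = c)
    {x y z : β} (h1 : Relation.ReflTransGen r x y) (h2 : Relation.ReflTransGen r x z)
    (hy : ∀ w, ¬ r y w) (hz : ∀ w, ¬ r z w) : y = z := by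
  induction h1 using Relation.ReflTransGen.head_induction_on with
  | refl =>
    rcases Relation.ReflTransGen.cases_head h2 with h | ⟨w, h, _⟩
    · exact h
    · exact absurd h (hy w)
  | head hab _ ih =>
    rcases Relation.ReflTransGen.cases_head h2 with h | ⟨w, h, h'⟩
    · subst h; exact absurd hab (hz _)
    · rw [hr _ _ _ hab h] at ih; exact ih h'

theorem kle_det {S : Q → Q → α → α → Prop}
    (hS : ∀ p q q' a b b', S p q a b → S p q' a b' → q = q' ∧ b = b')
    (R : List Q) (hR : R.Nodup) :
    ∀ p q q' a b b', q ∉ R → q' ∉ R → kle S R p q a b → kle S R p q' a b' →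
      q = q' ∧ b = b' := by
  induction R with
  | nil => exact fun p q q' a b b' _ _ => hS p q q' a b b'
  | cons r R ih =>
    rw [List.nodup_cons] at hR
    have ih := ih hR.2
    intro p q q' a b b' hq hq' h h'
    simp only [List.mem_cons, not_or] at hq hq'
    rcases h with h | ⟨u, v, h1, h2, h3⟩ <;> rcases h' with h' | ⟨u', v', h1', h2', h3'⟩
    · exact ih _ _ _ _ _ _ hq.2 hq'.2 h h'
    · exact absurd (ih _ _ _ _ _ _ hq.2 hR.1 h h1').1 hq.1
    · exact absurd (ih _ _ _ _ _ _ hq'.2 hR.1 h' h1).1 hq'.1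
    · obtain rfl := (ih _ _ _ _ _ _ hR.1 hR.1 h1 h1').2
      obtain rfl : v = v' := det_rtg_unique (r := kle S R r r)
        (fun a b c hb hc => (ih _ _ _ _ _ _ hR.1 hR.1 hb hc).2) h2 h2'
        (fun w hw => hq.1 (ih _ _ _ _ _ _ hq.2 hR.1 h3 hw).1)
        (fun w hw => hq'.1 (ih _ _ _ _ _ _ hq'.2 hR.1 h3' hw).1)
      exact ih _ _ _ _ _ _ hq.2 hq'.2 h3 h3'

theorem kle_sound (S : Q → Q → α → α → Prop) (R : List Q) :
    ∀ p q a b, kle S R p q a b → Relation.ReflTransGen (pairRel S) (p, a) (q, b) := by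
  induction R with
  | nil => exact fun p q a b h => Relation.ReflTransGen.single h
  | cons r R ih =>
    rintro p q a b (h | ⟨u, v, h1, h2, h3⟩)
    · exact ih _ _ _ _ h
    · have h1' := ih _ _ _ _ h1
      have h3' := ih _ _ _ _ h3
      refine h1'.trans (Relation.ReflTransGen.trans ?_ h3')
      clear h1 h3 h1' h3'
      induction h2 with
      | refl => exact .refl
      | tail _ h ih' => exact ih'.trans (ih _ _ _ _ h)

theorem kle_comp (S : Q → Q → α → α → Prop) (R : List Q) :
    ∀ p s q a u b, s ∈ R → kle S R p s a u → kle S R s q u b → kle S R p q a b := by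
  induction R with
  | nil => intro p s q a u b h; simp at h
  | cons r R ih =>
    intro p s q a u b hs h h'
    by_cases hsr : s = r
    · subst hsr
      right
      rcases h with h | ⟨w, v, h1, h2, h3⟩ <;> rcases h' with h' | ⟨w', v', h1', h2', h3'⟩
      · exact ⟨u, u, h, .refl, h'⟩
      · exact ⟨u, v', h, .head h1' h2', h3'⟩
      · exact ⟨w, u, h1, h2.tail h3, h'⟩
      · exact ⟨w, v', h1, (h2.tail h3).trans (.head h1' h2'), h3'⟩
    · have hs : s ∈ R := by simpa [hsr] using hs
      rcases h with h | ⟨w, v, h1, h2, h3⟩ <;> rcases h' with h' | ⟨w', v', h1', h2', h3'⟩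
      · exact .inl (ih _ _ _ _ _ _ hs h h')
      · exact .inr ⟨w', v', ih _ _ _ _ _ _ hs h h1', h2', h3'⟩
      · exact .inr ⟨w, v, h1, h2, ih _ _ _ _ _ _ hs h3 h'⟩
      · exact .inr ⟨w, v', h1, (h2.tail (ih _ _ _ _ _ _ hs h3 h1')).trans h2', h3'⟩

theorem kle_of_step (S : Q → Q → α → α → Prop) (R : List Q) :
    ∀ p q a b, S p q a b → kle S R p q a b := by
  induction R with
  | nil => exact fun p q a b h => h
  | cons r R ih => exact fun p q a b h => .inl (ih _ _ _ _ h)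

theorem kle_complete (S : Q → Q → α → α → Prop) (R : List Q) (hR : ∀ q, q ∈ R) (p q : Q) (a b : α) :
    Relation.ReflTransGen (pairRel S) (p, a) (q, b) ↔ (p = q ∧ a = b) ∨ kle S R p q a b := by
  constructor
  · intro h
    have : ∀ c, Relation.ReflTransGen (pairRel S) (p, a) c →
        (p = c.1 ∧ a = c.2) ∨ kle S R p c.1 a c.2 := by
      intro c hc
      induction hc with
      | refl => exact .inl ⟨rfl, rfl⟩
      | @tail b' c' _ hst ih =>
        right
        rcases ih with ⟨e1, e2⟩ | ih
        · rw [e1, e2]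
          exact kle_of_step _ _ _ _ _ _ hst
        · exact kle_comp _ _ _ _ _ _ _ _ (hR _) ih (kle_of_step _ _ _ _ _ _ hst)
    exact this _ h
  · rintro (⟨rfl, rfl⟩ | h)
    · exact .refl
    · exact kle_sound _ _ _ _ _ _ h

variable {Sig : Type} {k : ℕ} {C : Type}

theorem kle_dfn [Finite C]
    {S : Q → Q → ∀ g : LGraph Sig, (C → g.V) → (Fin k → g.V) → (Fin k → g.V) → Prop}
    (hS : ∀ g c p q q' a b b', S p q g c a b → S p q' g c a b' → q = q' ∧ b = b')
    (hD : ∀ p q, Dfn2 k (S p q)) (R : List Q) (hR : R.Nodup) :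
    ∀ p q, Dfn2 k (fun g c => kle (fun p q => S p q g c) R p q) := by
  induction R with
  | nil => exact hD
  | cons r R ih =>
    rw [List.nodup_cons] at hR
    have ih := ih hR.2
    intro p q
    have htc := Dfn2.tc (ih r r) (fun g c a b b' h h' =>
      (kle_det (hS g c) R hR.2 _ _ _ _ _ _ hR.1 hR.1 h h').2)
    refine Dfn.or (ih p q) ?_
    let f : (C ⊕ (Fin k ⊕ Fin k)) ⊕ (Fin k ⊕ Fin k) → (C ⊕ (Fin k ⊕ Fin k)) ⊕ (Fin k ⊕ Fin k) := id
    have h1 := (ih p r).reindex (C' := (C ⊕ (Fin k ⊕ Fin k)) ⊕ (Fin k ⊕ Fin k))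
      (Sum.elim (fun x => .inl (.inl x)) (Sum.elim (fun i => .inl (.inr (.inl i)))
        (fun i => .inr (.inl i))))
    have h2 := htc.reindex (C' := (C ⊕ (Fin k ⊕ Fin k)) ⊕ (Fin k ⊕ Fin k))
      (Sum.elim (fun x => .inl (.inl x)) (Sum.elim (fun i => .inr (.inl i))
        (fun i => .inr (.inr i))))
    have h3 := (ih r q).reindex (C' := (C ⊕ (Fin k ⊕ Fin k)) ⊕ (Fin k ⊕ Fin k))
      (Sum.elim (fun x => .inl (.inl x)) (Sum.elim (fun i => .inr (.inr i))
        (fun i => .inl (.inr (.inr i)))))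
    refine (h1.and (h2.and h3)).ex.congr ?_
    intro g c
    constructor
    · rintro ⟨u, v, h⟩
      exact ⟨Sum.elim u v, h⟩
    · rintro ⟨d, h⟩
      exact ⟨_, _, h⟩

theorem rtg_dfn [Finite C] [Finite Q]
    {S : Q → Q → ∀ g : LGraph Sig, (C → g.V) → (Fin k → g.V) → (Fin k → g.V) → Prop}
    (hS : ∀ g c p q q' a b b', S p q g c a b → S p q' g c a b' → q = q' ∧ b = b')
    (hD : ∀ p q, Dfn2 k (S p q)) (p q : Q) :
    Dfn2 k (fun g c a b =>
      Relation.ReflTransGen (pairRel (fun p q => S p q g c)) (p, a) (q, b)) := by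
  have := Fintype.ofFinite Q
  have h := kle_dfn hS hD Finset.univ.toList (Finset.nodup_toList _) p q
  have h2 : Dfn2 (C := C) (Sig := Sig) k (fun g c a b => p = q ∧ a = b) :=
    ((Dfn.const (p = q)).and (Dfn.forall_fin (fun i : Fin k =>
      Dfn.eq (C := C ⊕ (Fin k ⊕ Fin k)) (.inr (.inl i)) (.inr (.inr i))))).congr (fun g c => by
        simp only [funext_iff])
  exact (h2.or h).congr (fun g c => kle_complete _ _ (by simp) _ _ _ _)

end Kleene

section Levels

variable {Sig : Type} {k : ℕ}

/-- The pebble stack with names `l` and positions `π`. -/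
def stk {X V : Type} (l : List X) (π : X → V) : List (X × V) := l.map (fun x => (x, π x))

theorem mem_stk {X V : Type} (l : List X) (π : X → V) (x : X) (v : V) :
    (x, v) ∈ stk l π ↔ x ∈ l ∧ v = π x := by
  unfold stk
  simp only [List.mem_map, Prod.mk.injEq]
  constructor
  · rintro ⟨y, h, rfl, rfl⟩; exact ⟨h, rfl⟩
  · rintro ⟨h, rfl⟩; exact ⟨x, h, rfl, rfl⟩

/-- Instructions that do not change the stack. -/
def Simple {X : Type} : GInstr Sig k X → Prop
  | .dropPeb _ _ => False
  | .retrieve _ => False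
  | _ => True

/-- A simple step at level `l`. -/
def SStep (A : GWA Sig k) (l : List A.X) (p q : A.Q) (g : LGraph Sig) (π : A.X → g.V)
    (a b : Fin k → g.V) : Prop :=
  ∃ t ∈ A.instr, t.1 = p ∧ t.2.2 = q ∧ Simple t.2.1 ∧
    gInstrStep g t.2.1 a (stk l π) b (stk l π)

open Classical in
/-- A compound step at level `l`, with at most `n` further pebbles. -/
def LStep (A : GWA Sig k) : ℕ → List A.X → A.Q → A.Q → ∀ (g : LGraph Sig) (_ : A.X → g.V)
    (_ _ : Fin k → g.V), Prop
  | 0, l, p, q, g, π, a, b => SStep A l p q g π a b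
  | n + 1, l, p, q, g, π, a, b => SStep A l p q g π a b ∨
      ∃ (i : Fin k) (x : A.X) (p' q' : A.Q), (x ∉ l ∧ (p, .dropPeb i x, p') ∈ A.instr ∧
        (q', .retrieve x, q) ∈ A.instr) ∧
        Relation.ReflTransGen
          (pairRel (fun p q => LStep A n (x :: l) p q g (Function.update π x (a i)))) (p', a) (q', b)

theorem instr_unique {A : GWA Sig k} (hA : GDeterministic A) {p q q' : A.Q}
    {ins ins' : GInstr Sig k A.X} (h : (p, ins, q) ∈ A.instr) (h' : (p, ins', q') ∈ A.instr)
    (hn : ∀ b τ, ins ≠ .test b τ) : ins = ins' ∧ q = q' := by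
  by_contra hne
  rcases hA _ _ _ _ _ h h' (fun e => hne (by simpa using e)) with ⟨b, τ, h1, h2⟩ | ⟨b, τ, h1, h2⟩
  · exact hn _ _ h1
  · exact hn _ _ h2

theorem sstep_det {A : GWA Sig k} (hA : GDeterministic A) {l : List A.X} {p q q' : A.Q}
    {g : LGraph Sig} {π : A.X → g.V} {a b b' : Fin k → g.V}
    (h : SStep A l p q g π a b) (h' : SStep A l p q' g π a b') : q = q' ∧ b = b' := by
  obtain ⟨⟨p1, ins, q1⟩, ht, rfl, rfl, hs, hi⟩ := h
  obtain ⟨⟨p2, ins', q2⟩, ht', hp, rfl, hs', hi'⟩ := h'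
  simp only at hp ht ht' hs hs' hi hi' ⊢
  subst hp
  have hsame : ins = ins' ∧ q1 = q2 := by
    by_contra hne
    rcases hA _ _ _ _ _ ht ht' (fun e => hne (by simpa using e)) with
      ⟨b, τ, rfl, rfl⟩ | ⟨b, τ, rfl, rfl⟩ <;>
    · have h1 := hi.2.2
      have h2 := hi'.2.2
      rw [h1] at h2
      cases b <;> simp at h2
  obtain ⟨rfl, rfl⟩ := hsame
  refine ⟨rfl, ?_⟩
  cases ins with
  | inmove i c =>
    obtain ⟨-, h1, h2⟩ := hi
    obtain ⟨-, h1', h2'⟩ := hi'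
    funext j
    by_cases hj : j = i
    · subst hj; exact g.in_unique _ _ _ _ h1 h1'
    · rw [h2 j hj, h2' j hj]
  | outmove i c =>
    obtain ⟨-, h1, h2⟩ := hi
    obtain ⟨-, h1', h2'⟩ := hi'
    funext j
    by_cases hj : j = i
    · subst hj; exact g.out_unique _ _ _ _ h1 h1'
    · rw [h2 j hj, h2' j hj]
  | dropPeb i x => exact hs.elim
  | retrieve x => exact hs.elim
  | jump i x =>
    obtain ⟨-, h1, h2⟩ := hi
    obtain ⟨-, h1', h2'⟩ := hi'
    funext j
    by_cases hj : j = i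
    · subst hj
      rw [mem_stk] at h1 h1'
      rw [h1.2, h1'.2]
    · rw [h2 j hj, h2' j hj]
  | test b τ => rw [hi.1, hi'.1]

theorem no_sstep {A : GWA Sig k} (hA : GDeterministic A) {l : List A.X} {p q q' : A.Q}
    {g : LGraph Sig} {π : A.X → g.V} {a b : Fin k → g.V} {ins : GInstr Sig k A.X}
    (ht : (p, ins, q') ∈ A.instr) (hns : ¬ Simple ins) : ¬ SStep A l p q g π a b := by
  rintro ⟨⟨p1, ins', q1⟩, ht', rfl, rfl, hs, hi⟩
  have := (instr_unique hA ht ht' (by rintro b τ rfl; exact hns trivial)).1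
  subst this
  exact hns hs

theorem no_lstep_of_retrieve {A : GWA Sig k} (hA : GDeterministic A) {n : ℕ} {l : List A.X}
    {p q q' : A.Q} {g : LGraph Sig} {π : A.X → g.V} {a b : Fin k → g.V} {x : A.X}
    (ht : (p, .retrieve x, q') ∈ A.instr) : ¬ LStep A n l p q g π a b := by
  have h0 : ¬ SStep A l p q g π a b := no_sstep hA ht (fun h => h)
  cases n with
  | zero => exact h0
  | succ n =>
    rintro (h | ⟨i, y, p', q'', ⟨_, h, _⟩, _⟩)
    · exact h0 h
    · have := (instr_unique hA ht h (by simp)).1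
      simp at this

theorem lstep_det {A : GWA Sig k} (hA : GDeterministic A) (n : ℕ) :
    ∀ (l : List A.X) (g : LGraph Sig) (π : A.X → g.V) (p q q' : A.Q) (a b b' : Fin k → g.V),
    LStep A n l p q g π a b → LStep A n l p q' g π a b' → q = q' ∧ b = b' := by
  induction n with
  | zero => exact fun l g π p q q' a b b' h h' => sstep_det hA h h'
  | succ n ih =>
    intro l g π p q q' a b b' h h'
    rcases h with h | ⟨i, x, r, s, ⟨hx, h1, h2⟩, h3⟩ <;>
      rcases h' with h' | ⟨i', x', r', s', ⟨hx', h1', h2'⟩, h3'⟩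
    · exact sstep_det hA h h'
    · exact absurd h (no_sstep hA h1' (fun h => h))
    · exact absurd h' (no_sstep hA h1 (fun h => h))
    · obtain ⟨e1, e2⟩ := instr_unique hA h1 h1' (by simp)
      obtain ⟨rfl, rfl⟩ : i = i' ∧ x = x' := by simpa using e1
      subst e2
      have := det_rtg_unique (fun c c1 c2 hc1 hc2 => by
          obtain ⟨e1, e2⟩ := ih _ _ _ _ _ _ _ _ _ hc1 hc2
          exact Prod.ext e1 e2) h3 h3'
        (fun w hw => no_lstep_of_retrieve hA h2 hw) (fun w hw => no_lstep_of_retrieve hA h2' hw)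
      simp only [Prod.mk.injEq] at this
      obtain ⟨rfl, rfl⟩ := this
      exact ⟨(instr_unique hA h2 h2' (by simp)).2, rfl⟩

theorem test_dfn {X : Type} [Finite X] (l : List X) (τ : GTest Sig k X) :
    Dfn (Sig := Sig) k (C := X ⊕ Fin k) (fun g c =>
      gTestHolds g τ (fun i => c (.inr i)) (stk l (fun x => c (.inl x)))) := by
  cases τ with
  | lab i a => exact Dfn.lab a _
  | inedge i a => exact Dfn.ex1 (Dfn.edg (C := (X ⊕ Fin k) ⊕ Unit) a (.inr ()) (.inl (.inr i)))
  | outedge i a => exact Dfn.ex1 (Dfn.edg (C := (X ⊕ Fin k) ⊕ Unit) a (.inl (.inr i)) (.inr ()))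
  | peb i x =>
    exact ((Dfn.const (x ∈ l)).and (Dfn.eq (C := X ⊕ Fin k) (.inr i) (.inl x))).congr
      (fun g c => mem_stk _ _ _ _)

theorem others_dfn {X : Type} (i : Fin k) :
    Dfn2 (Sig := Sig) k (C := X) (fun _ _ a b => ∀ h, h ≠ i → b h = a h) := by
  have : ∀ h : Fin k, Dfn (Sig := Sig) k (C := X ⊕ (Fin k ⊕ Fin k))
      (fun g c => h ≠ i → c (.inr (.inr h)) = c (.inr (.inl h))) := fun h =>
    ((Dfn.const (h = i)).or (Dfn.eq _ _)).congr (fun g c => by tauto)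
  exact Dfn.forall_fin this

theorem instr_dfn {X : Type} [Finite X] (l : List X) (ins : GInstr Sig k X) :
    Dfn2 (Sig := Sig) k (C := X) (fun g π a b =>
      Simple ins ∧ gInstrStep g ins a (stk l π) b (stk l π)) := by
  cases ins with
  | inmove i a =>
    exact ((Dfn.edg (C := X ⊕ (Fin k ⊕ Fin k)) a (.inr (.inr i)) (.inr (.inl i))).and (others_dfn i)).congr
      (fun g c => by simp [Simple, gInstrStep])
  | outmove i a =>
    exact ((Dfn.edg (C := X ⊕ (Fin k ⊕ Fin k)) a (.inr (.inl i)) (.inr (.inr i))).and (others_dfn i)).congr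
      (fun g c => by simp [Simple, gInstrStep])
  | dropPeb i x => exact (Dfn.const False).congr (fun g c => by simp [Simple])
  | retrieve x => exact (Dfn.const False).congr (fun g c => by simp [Simple])
  | jump i x =>
    exact (((Dfn.const (x ∈ l)).and (Dfn.eq (C := X ⊕ (Fin k ⊕ Fin k)) (.inr (.inr i)) (.inl x))).and (others_dfn i)).congr
      (fun g c => by simp [Simple, gInstrStep, mem_stk])
  | test b τ =>
    have h := (test_dfn l τ).reindex (C' := X ⊕ (Fin k ⊕ Fin k))
      (Sum.elim (fun x => .inl x) (fun i => .inr (.inl i)))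
    have h2 : Dfn2 (Sig := Sig) k (C := X) (fun g c a b => b = a) :=
      (Dfn.forall_fin (fun i : Fin k => Dfn.eq (C := X ⊕ (Fin k ⊕ Fin k)) (.inr (.inr i)) (.inr (.inl i)))).congr
        (fun g c => by simp only [funext_iff])
    cases b with
    | true => exact (h2.and h).congr (fun g c => by simp [Simple, gInstrStep])
    | false => exact (h2.and h.not).congr (fun g c => by simp [Simple, gInstrStep])

theorem sstep_dfn (A : GWA Sig k) (l : List A.X) (p q : A.Q) : Dfn2 k (SStep A l p q) := by
  have := A.finX
  refine Dfn.exists_mem A.instrFin (fun t => ?_)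
  exact ((Dfn.const (t.1 = p)).and ((Dfn.const (t.2.2 = q)).and (instr_dfn l t.2.1)))

theorem lstep_dfn {A : GWA Sig k} (hA : GDeterministic A) (n : ℕ) :
    ∀ (l : List A.X) (p q : A.Q), Dfn2 k (LStep A n l p q) := by
  classical
  have := A.finX
  have := A.finQ
  induction n with
  | zero => exact fun l p q => sstep_dfn A l p q
  | succ n ih =>
    intro l p q
    refine Dfn.or (sstep_dfn A l p q) ?_
    refine Dfn.exists_fin fun i => Dfn.exists_fin fun x => Dfn.exists_fin fun p' =>
      Dfn.exists_fin fun q' => Dfn.and (Dfn.const _) ?_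
    have h := rtg_dfn (fun g c p q q' a b b' => lstep_det hA n (x :: l) g c p q q' a b b')
      (ih (x :: l)) p' q'
    have h' := h.reindex (C' := A.X ⊕ (Fin k ⊕ Fin k))
      (Sum.elim (fun y => if y = x then .inr (.inl i) else .inl y) .inr)
    refine h'.congr (fun g c => ?_)
    have e : Function.update (fun x => c (.inl x)) x (c (.inr (.inl i))) =
        fun y => c (if y = x then .inr (.inl i) else .inl y) := by
      funext y
      by_cases hy : y = x
      · subst hy; simp
      · simp [hy]
    simp only [Sum.elim_inl, Sum.elim_inr]
    rw [← e]

theorem stk_update {X V : Type} [DecidableEq X] (l : List X) (π : X → V) (x : X) (v : V)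
    (hx : x ∉ l) : stk l (Function.update π x v) = stk l π := by
  unfold stk
  apply List.map_congr_left
  intro y hy
  have hne : y ≠ x := by
    rintro rfl
    exact hx hy
  rw [Function.update_of_ne hne]

theorem stk_cons_update {X V : Type} [DecidableEq X] (l : List X) (π : X → V) (x : X) (v : V)
    (hx : x ∉ l) : stk (x :: l) (Function.update π x v) = (x, v) :: stk l π := by
  rw [← stk_update l π x v hx]
  simp [stk]

theorem sstep_sound {A : GWA Sig k} {l : List A.X} {p q : A.Q}
    {g : LGraph Sig} {π : A.X → g.V} {a b : Fin k → g.V} (h : SStep A l p q g π a b) :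
    GStep A g (p, a, stk l π) (q, b, stk l π) := by
  obtain ⟨⟨p1, ins, q1⟩, ht, rfl, rfl, hs, hi⟩ := h
  exact ⟨ins, ht, hi⟩

theorem lstep_sound (A : GWA Sig k) (n : ℕ) :
    ∀ (l : List A.X) (g : LGraph Sig) (π : A.X → g.V) (p q : A.Q) (a b : Fin k → g.V),
    LStep A n l p q g π a b →
      Relation.ReflTransGen (GStep A g) (p, a, stk l π) (q, b, stk l π) := by
  classical
  induction n with
  | zero => exact fun l g π p q a b h => .single (sstep_sound h)
  | succ n ih =>
    rintro l g π p q a b (h | ⟨i, x, p', q', ⟨hx, h1, h2⟩, h3⟩)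
    · exact .single (sstep_sound h)
    · have e := stk_cons_update l π x (a i) hx
      refine Relation.ReflTransGen.head (b := (p', a, (x, a i) :: stk l π)) ⟨_, h1, rfl, rfl, ?_⟩ ?_
      · intro w hw; rw [mem_stk] at hw; exact hx hw.1
      · refine Relation.ReflTransGen.tail (b := (q', b, (x, a i) :: stk l π)) ?_ ⟨_, h2, rfl, a i, rfl⟩
        have : ∀ c, Relation.ReflTransGen
          (pairRel (fun p q => LStep A n (x :: l) p q g (Function.update π x (a i)))) (p', a) c →
          Relation.ReflTransGen (GStep A g) (p', a, (x, a i) :: stk l π) (c.1, c.2, (x, a i) :: stk l π) := by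
          intro c hc
          induction hc with
          | refl => exact .refl
          | tail _ h ih' =>
            have := ih _ _ _ _ _ _ _ h
            rw [e] at this
            exact ih'.trans this
        refine this (q', b) ?_
        convert h3

open Classical in
/-- The run at the level of the stack `l`, nested inside runs at lower levels. -/
def Tower (A : GWA Sig k) (g : LGraph Sig) (N : ℕ) (πi : A.X → g.V) (p0 : A.Q) (a0 : Fin k → g.V) :
    List A.X → (A.X → g.V) → A.Q → (Fin k → g.V) → Prop
  | [], π, q, b => π = πi ∧ Relation.ReflTransGen
      (pairRel (fun p q => LStep A N [] p q g π)) (p0, a0) (q, b)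
  | x :: l, π, q, b => ∃ (π0 : A.X → g.V) (p : A.Q) (a : Fin k → g.V) (i : Fin k) (p' : A.Q),
      Tower A g N πi p0 a0 l π0 p a ∧ x ∉ l ∧ (p, .dropPeb i x, p') ∈ A.instr ∧
      π = Function.update π0 x (a i) ∧
      Relation.ReflTransGen
        (pairRel (fun p q => LStep A (N - (l.length + 1)) (x :: l) p q g π)) (p', a) (q, b)

theorem tower_step {A : GWA Sig k} {g : LGraph Sig} {N : ℕ} {πi : A.X → g.V} {p0 : A.Q} {a0 : Fin k → g.V}
    {l : List A.X} {π : A.X → g.V} {q q' : A.Q} {b b' : Fin k → g.V}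
    (h : Tower A g N πi p0 a0 l π q b) (hs : LStep A (N - l.length) l q q' g π b b') :
    Tower A g N πi p0 a0 l π q' b' := by
  cases l with
  | nil =>
    obtain ⟨rfl, h⟩ := h
    exact ⟨rfl, Relation.ReflTransGen.tail h hs⟩
  | cons x l =>
    obtain ⟨π0, p, a, i, p', h1, h2, h3, h4, h5⟩ := h
    exact ⟨π0, p, a, i, p', h1, h2, h3, h4, h5.tail hs⟩

theorem lstep_of_sstep {A : GWA Sig k} {n : ℕ} {l : List A.X} {p q : A.Q}
    {g : LGraph Sig} {π : A.X → g.V} {a b : Fin k → g.V} (h : SStep A l p q g π a b) :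
    LStep A n l p q g π a b := by
  cases n with
  | zero => exact h
  | succ n => exact .inl h

theorem tower_nodup {A : GWA Sig k} {g : LGraph Sig} {N : ℕ} {πi : A.X → g.V} {p0 : A.Q} {a0 : Fin k → g.V}
    (l : List A.X) : ∀ {π : A.X → g.V} {q : A.Q} {b : Fin k → g.V},
    Tower A g N πi p0 a0 l π q b → l.Nodup := by
  induction l with
  | nil => intros; exact List.nodup_nil
  | cons x l ih =>
    rintro π q b ⟨π0, p, a, i, p', h1, h2, _⟩
    exact List.nodup_cons.2 ⟨h2, ih h1⟩

theorem tower_gstep {A : GWA Sig k} {g : LGraph Sig} {N : ℕ} {πi : A.X → g.V} {p0 : A.Q} {a0 : Fin k → g.V}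
    (hN : ∀ l : List A.X, l.Nodup → l.length ≤ N)
    {l : List A.X} {π : A.X → g.V} {q q' : A.Q} {b b' : Fin k → g.V} {σ' : List (A.X × g.V)}
    (h : Tower A g N πi p0 a0 l π q b) (hs : GStep A g (q, b, stk l π) (q', b', σ')) :
    ∃ l' π', σ' = stk l' π' ∧ Tower A g N πi p0 a0 l' π' q' b' := by
  classical
  obtain ⟨ins, ht, hi⟩ := hs
  simp only at ht hi
  have hsim : Simple ins → σ' = stk l π → ∃ l' π', σ' = stk l' π' ∧ Tower A g N πi p0 a0 l' π' q' b' := by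
    rintro h1 rfl
    exact ⟨l, π, rfl, tower_step h (lstep_of_sstep ⟨_, ht, rfl, rfl, h1, hi⟩)⟩
  cases ins with
  | inmove i c => exact hsim trivial hi.1
  | outmove i c => exact hsim trivial hi.1
  | jump i c => exact hsim trivial hi.1
  | test c τ => exact hsim trivial hi.2.1
  | dropPeb i x =>
    obtain ⟨rfl, rfl, hx⟩ := hi
    have hx : x ∉ l := fun hl => hx (π x) ((mem_stk _ _ _ _).2 ⟨hl, rfl⟩)
    refine ⟨x :: l, Function.update π x (b' i), (stk_cons_update _ _ _ _ hx).symm, ?_⟩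
    refine ⟨π, q, b', i, q', h, hx, ht, ?_, .refl⟩
    congr
  | retrieve x =>
    obtain ⟨rfl, w, hw⟩ := hi
    cases l with
    | nil => simp [stk] at hw
    | cons y l =>
      have hw' : (y = x ∧ π y = w) ∧ stk l π = σ' := by simpa [stk] using hw
      obtain ⟨⟨rfl, -⟩, rfl⟩ := hw'
      have hnd := tower_nodup _ h
      obtain ⟨π0, p, a, i, p', h1, h2, h3, h4, h5⟩ := h
      refine ⟨l, π0, ?_, tower_step h1 ?_⟩
      · rw [h4, stk_update _ _ _ _ h2]
      · have hlen := hN _ hnd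
        simp only [List.length_cons] at hlen
        obtain ⟨n, hn⟩ : ∃ n, N - l.length = n + 1 := ⟨N - l.length - 1, by omega⟩
        have hn' : N - (l.length + 1) = n := by omega
        rw [hn]
        rw [hn', h4] at h5
        exact .inr ⟨i, y, p', q, ⟨h2, h3, ht⟩, h5⟩

theorem runs_iff (A : GWA Sig k) (g : LGraph Sig) (N : ℕ)
    (hN : ∀ l : List A.X, l.Nodup → l.length ≤ N) (p q : A.Q) (a b : Fin k → g.V) (π : A.X → g.V) :
    Relation.ReflTransGen (GStep A g) (p, a, []) (q, b, []) ↔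
    Relation.ReflTransGen (pairRel (fun p q => LStep A N [] p q g π)) (p, a) (q, b) := by
  constructor
  · intro h
    have : ∀ c, Relation.ReflTransGen (GStep A g) (p, a, []) c →
      ∃ l π', c.2.2 = stk l π' ∧ Tower A g N π p a l π' c.1 c.2.1 := by
      intro c hc
      induction hc with
      | refl => exact ⟨[], π, rfl, rfl, .refl⟩
      | @tail c c' _ hst ih =>
        obtain ⟨l, π', e, ht⟩ := ih
        obtain ⟨q1, b1, σ⟩ := c
        obtain ⟨q2, b2, σ'⟩ := c'
        simp only at e
        subst e
        exact tower_gstep hN ht hst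
    obtain ⟨l, π', e, ht⟩ := this _ h
    cases l with
    | nil =>
      obtain ⟨rfl, ht⟩ := ht
      exact ht
    | cons x l => simp [stk] at e
  · intro h
    have : ∀ c, Relation.ReflTransGen (pairRel (fun p q => LStep A N [] p q g π)) (p, a) c →
      Relation.ReflTransGen (GStep A g) (p, a, []) (c.1, c.2, []) := by
      intro c hc
      induction hc with
      | refl => exact .refl
      | tail _ h ih' => exact ih'.trans (lstep_sound A N [] g π _ _ _ _ h)
    exact this _ h

end Levels

end NestedPebblesGraphs


namespace NestedPebblesGraphs

section Inclusion

variable {Sig : Type} {k : ℕ}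

/-- An instruction is executable with an empty stack. -/
def Enab {X : Type} (g : LGraph Sig) (a : Fin k → g.V) : GInstr Sig k X → Prop
  | .inmove i c => ∃ u, g.edge c u (a i)
  | .outmove i c => ∃ u, g.edge c (a i) u
  | .dropPeb _ _ => True
  | .retrieve _ => False
  | .jump _ _ => False
  | .test b τ => gTestHolds g τ a [] ↔ b = true

theorem enab_iff {X : Type} (g : LGraph Sig) (a : Fin k → g.V) (ins : GInstr Sig k X) :
    Enab g a ins ↔ ∃ b σ, gInstrStep g ins a [] b σ := by
  classical
  cases ins with
  | inmove i c =>
    constructor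
    · rintro ⟨u, hu⟩
      exact ⟨Function.update a i u, [], rfl, by simpa using hu, fun h hh => by simp [hh]⟩
    · rintro ⟨b, σ, _, h, _⟩
      exact ⟨_, h⟩
  | outmove i c =>
    constructor
    · rintro ⟨u, hu⟩
      exact ⟨Function.update a i u, [], rfl, by simpa using hu, fun h hh => by simp [hh]⟩
    · rintro ⟨b, σ, _, h, _⟩
      exact ⟨_, h⟩
  | dropPeb i x => simp [Enab, gInstrStep]
  | retrieve x => simp [Enab, gInstrStep]
  | jump i x => simp [Enab, gInstrStep]
  | test b τ => simp [Enab, gInstrStep]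

theorem halting_iff (A : GWA Sig k) (g : LGraph Sig) (q : A.Q) (a : Fin k → g.V) :
    GHaltingConf A g (q, a, []) ↔ ¬ ∃ t ∈ A.instr, t.1 = q ∧ Enab g a t.2.1 := by
  unfold GHaltingConf
  rw [not_exists]
  constructor
  · rintro h ⟨p, ins, q'⟩ ⟨ht, rfl, he⟩
    rw [enab_iff] at he
    obtain ⟨b, σ, hb⟩ := he
    exact h (q', b, σ) ⟨ins, ht, hb⟩
  · rintro h ⟨q', b, σ⟩ ⟨ins, ht, hb⟩
    exact h (q, ins, q') ⟨ht, rfl, (enab_iff _ _ _).2 ⟨b, σ, hb⟩⟩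

theorem enab_dfn {X : Type} [Finite X] (ins : GInstr Sig k X) :
    Dfn (Sig := Sig) k (C := X ⊕ Fin k) (fun g c => Enab g (fun i => c (.inr i)) ins) := by
  cases ins with
  | inmove i a => exact Dfn.ex1 (Dfn.edg (C := (X ⊕ Fin k) ⊕ Unit) a (.inr ()) (.inl (.inr i)))
  | outmove i a => exact Dfn.ex1 (Dfn.edg (C := (X ⊕ Fin k) ⊕ Unit) a (.inl (.inr i)) (.inr ()))
  | dropPeb i x => exact Dfn.const True
  | retrieve x => exact Dfn.const False
  | jump i x => exact Dfn.const False
  | test b τ =>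
    have h := test_dfn (Sig := Sig) (k := k) (X := X) [] τ
    cases b with
    | true => exact h.congr (fun g c => by simp [Enab, stk])
    | false => exact h.not.congr (fun g c => by simp [Enab, stk])

theorem accepts_dfn {A : GWA Sig k} (hA : GDeterministic A) :
    Dfn (Sig := Sig) k (C := Empty) (fun g _ => GAccepts A g) := by
  classical
  have := A.finX
  have := A.finQ
  have hN : ∀ l : List A.X, l.Nodup → l.length ≤ Fintype.card A.X :=
    fun l hl => hl.length_le_card
  have hrun := fun q => rtg_dfn
    (fun g c p q q' a b b' => lstep_det hA (Fintype.card A.X) [] g c p q q' a b b')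
    (lstep_dfn hA (Fintype.card A.X) []) A.q0 q
  have hrun' := fun q => (hrun q).reindex (C' := (Empty ⊕ Unit) ⊕ Fin k)
    (Sum.elim (fun _ => .inl (.inr ())) (Sum.elim (fun _ => .inl (.inr ())) (fun i => .inr i)))
  have hhalt : ∀ q, Dfn (Sig := Sig) k (C := (Empty ⊕ Unit) ⊕ Fin k)
      (fun g c => GHaltingConf A g (q, fun i => c (.inr i), [])) := fun q => by
    refine Dfn.congr (Dfn.not (Dfn.exists_mem A.instrFin (fun t => (Dfn.const (t.1 = q)).and
      ((enab_dfn t.2.1).reindex (C' := (Empty ⊕ Unit) ⊕ Fin k)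
        (Sum.elim (fun _ => .inl (.inr ())) .inr))))) (fun g c => halting_iff A g q _)
  have hin : ∀ q, Dfn (Sig := Sig) k (C := Empty ⊕ Unit) (fun g c => ∃ hs : Fin k → g.V, q ∈ A.acc ∧
      Relation.ReflTransGen (GStep A g) (A.q0, fun _ => c (.inr ()), []) (q, hs, []) ∧
      GHaltingConf A g (q, hs, [])) := fun q => by
    refine (Dfn.ex ((Dfn.const (q ∈ A.acc)).and ((hrun' q).and (hhalt q)))).congr (fun g c => ?_)
    refine exists_congr fun hs => and_congr Iff.rfl (and_congr ?_ Iff.rfl)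
    exact runs_iff A g _ hN _ _ _ _ (fun _ => c (.inr ()))
  refine ((Dfn.exists_fin hin).not.ex1).not.congr (fun g c => ?_)
  rw [not_exists]
  refine forall_congr' fun u => ?_
  rw [not_not]
  exact Iff.rfl

theorem DPTWAgJ_subset_FODTCg (Sig : Type) (k : ℕ) :
    DPTWAgJ Sig Set.univ k ⊆ FODTCg Sig Set.univ k := by
  rintro L ⟨A, hA, -, rfl⟩
  have := (accepts_dfn hA).language
  simpa using this

/-- The first-order sentence saying that all labels are `z`. -/
def allz (k : ℕ) (z : Sig) : GForm Sig k := .all 0 (.lab z 0)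

theorem allz_sat (z : Sig) (g : LGraph Sig) :
    (∀ v : g.V, g.nlab v = z) ↔ ∀ ν : ℕ → g.V, GSat g (allz k z) ν := by
  constructor
  · intro h ν u
    exact h _
  · intro h v
    have := h (fun _ => v) v
    simpa [GSat] using this

theorem allz_spec (Sig : Type) (z : Sig) (k : ℕ) :
    ∃ φ : GForm Sig k, GTCFree φ ∧ GWF φ ∧ gfree φ = ∅ ∧
      {g : LGraph Sig | ∀ v : g.V, g.nlab v = z} =
        {g | ∀ ν : ℕ → g.V, GSat g φ ν} :=
  ⟨allz k z, trivial, trivial, by simp [allz, gfree], Set.ext fun g => allz_sat z g⟩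

theorem allz_mem (Sig : Type) (z : Sig) (k : ℕ) :
    {g : LGraph Sig | ∀ v : g.V, g.nlab v = z} ∈ FODTCg Sig Set.univ k :=
  ⟨allz k z, trivial, trivial, by simp [allz, gfree], Set.ext fun g => by
    simpa using allz_sat z g⟩

end Inclusion

end NestedPebblesGraphs


namespace NestedPebblesGraphs

section Jag

set_option linter.unusedSectionVars false

variable {S T G : Type}

/-- Synchronous step of an abstract jumping automaton: the tokens `T` only see which tokens
coincide. -/
def jstep (δ : S → (T → T → Prop) → S × (T → T) × (T → G)) {Y : Type} (mv : G → Y → Y)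
    (c : S × (T → Y)) : S × (T → Y) :=
  ((δ c.1 (fun i j => c.2 i = c.2 j)).1,
    fun j => mv ((δ c.1 (fun i j => c.2 i = c.2 j)).2.2 j)
      (c.2 ((δ c.1 (fun i j => c.2 i = c.2 j)).2.1 j)))

/-- Apply a map to all token positions. -/
def mapc {Y Z : Type} (f : Y → Z) (c : S × (T → Y)) : S × (T → Z) := (c.1, fun j => f (c.2 j))

theorem jstep_mapc (δ : S → (T → T → Prop) → S × (T → T) × (T → G)) {Y Z : Type}
    {mv : G → Y → Y} {mv' : G → Z → Z} {f : Y → Z} (hf : ∀ d y, f (mv d y) = mv' d (f y))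
    {c : S × (T → Y)} (hc : ∀ i j, f (c.2 i) = f (c.2 j) → c.2 i = c.2 j) :
    jstep δ mv' (mapc f c) = mapc f (jstep δ mv c) := by
  have hk : (fun i j => (mapc f c).2 i = (mapc f c).2 j) = (fun i j => c.2 i = c.2 j) := by
    funext i j
    exact propext ⟨hc i j, fun h => congrArg f h⟩
  unfold jstep
  rw [hk]
  simp only [mapc, hf]

variable [Group G]

/-- Moves in the group. -/
def mvR (d g : G) : G := g * d

/-- Moves in disjoint copies of the group. -/
def mvV (d : G) (y : T × G) : T × G := (y.1, y.2 * d)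

/-- Interpretation of virtual positions. -/
def vint (h : T → G) (y : T × G) : G := h y.1 * y.2

theorem vint_mv (h : T → G) (d : G) (y : T × G) : vint h (mvV d y) = mvR d (vint h y) := by
  simp [vint, mvV, mvR, mul_assoc]

variable [Fintype T] [DecidableEq T]

/-- Number of copies in use. -/
def nl (v : S × (T → T × G)) : ℕ := (Finset.univ.image (fun j => (v.2 j).1)).card

theorem nl_jstep (δ : S → (T → T → Prop) → S × (T → T) × (T → G)) (v : S × (T → T × G)) :
    nl (jstep δ mvV v) ≤ nl v := by
  apply Finset.card_le_card
  intro l hl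
  simp only [Finset.mem_image, Finset.mem_univ, true_and] at hl ⊢
  obtain ⟨j, rfl⟩ := hl
  exact ⟨_, rfl⟩

theorem nl_iter (δ : S → (T → T → Prop) → S × (T → T) × (T → G)) (v : S × (T → T × G)) (n : ℕ) :
    nl ((jstep δ mvV)^[n] v) ≤ nl v := by
  induction n with
  | zero => exact le_rfl
  | succ n ih =>
    rw [Function.iterate_succ_apply']
    exact (nl_jstep _ _).trans ih

/-- Merge two copies. -/
def mergeMap (a : T → T × G) (i j : T) (d : G) (y : T × G) : T × G :=
  if y.1 = (a j).1 then ((a i).1, (a i).2 * d * (a j).2⁻¹ * y.2) else y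

theorem merge_vint (h : T → G) (a : T → T × G) (i j : T) (d : G)
    (hd : vint h (a i) * d = vint h (a j)) (y : T × G) :
    vint h (mergeMap a i j d y) = vint h y := by
  unfold mergeMap
  split_ifs with hy
  · have : h (a i).1 * (a i).2 * d = h y.1 * (a j).2 := by rw [hy]; exact hd
    calc h (a i).1 * ((a i).2 * d * (a j).2⁻¹ * y.2)
        = (h (a i).1 * (a i).2 * d) * (a j).2⁻¹ * y.2 := by group
      _ = _ := by rw [this]; simp [vint]
  · rfl

theorem merge_nl (v : S × (T → T × G)) (i j : T) (d : G) (hij : (v.2 i).1 ≠ (v.2 j).1) :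
    nl (mapc (mergeMap v.2 i j d) v) < nl v := by
  apply Finset.card_lt_card
  rw [Finset.ssubset_iff_of_subset]
  · refine ⟨(v.2 j).1, by simp, ?_⟩
    simp only [Finset.mem_image, Finset.mem_univ, true_and, not_exists, mapc, mergeMap]
    intro m
    split_ifs with h
    · exact hij
    · exact h
  · intro l hl
    simp only [Finset.mem_image, Finset.mem_univ, true_and, mapc, mergeMap] at hl ⊢
    obtain ⟨m, rfl⟩ := hl
    split_ifs with h
    · exact ⟨i, rfl⟩
    · exact ⟨m, rfl⟩

/-- The inductive claim in the Cook-Rackoff argument. -/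
def Claim (δ : S → (T → T → Prop) → S × (T → T) × (T → G)) (c B R : ℕ) : Prop :=
  ∃ W : Finset (S × (T → T × G)), W.card ≤ R ∧ ∀ x : S × (T → G),
    (∃ i j, i < j ∧ j ≤ B ∧ (jstep δ mvR)^[i] x = (jstep δ mvR)^[j] x) ∨
    ∃ s ≤ B, ∃ v ∈ W, nl v ≤ c ∧ ∃ h : T → G, (jstep δ mvR)^[s] x = mapc (vint h) v

theorem claim_base [Fintype S] (δ : S → (T → T → Prop) → S × (T → T) × (T → G)) :
    Claim δ (Fintype.card T) 0 (Fintype.card S) := by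
  classical
  refine ⟨Finset.univ.image (fun q : S => (q, fun j => (j, 1))), Finset.card_image_le, ?_⟩
  intro x
  refine .inr ⟨0, le_rfl, (x.1, fun j => (j, 1)), by simp, Finset.card_le_univ _, x.2, ?_⟩
  simp [mapc, vint]

theorem alpha_iter (φ : Equiv.Perm T) (u : T → G) (α : T × G → T × G)
    (hα : ∀ y, α y = (φ y.1, u y.1 * y.2)) (m : ℕ) (hm : ∀ g : G, g ^ m = 1) (y : T × G) :
    α^[(Fintype.card T).factorial * m] y = y := by
  have h1 : ∀ n y, (α^[n] y).1 = (φ ^ n) y.1 := by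
    intro n
    induction n with
    | zero => intro y; rfl
    | succ n ih =>
      intro y
      rw [Function.iterate_succ_apply', hα, pow_succ', Equiv.Perm.mul_apply, ih]
  have h2 : ∀ n l g, (α^[n] (l, g)).2 = (α^[n] (l, 1)).2 * g := by
    intro n
    induction n with
    | zero => intro l g; simp
    | succ n ih =>
      intro l g
      rw [Function.iterate_succ_apply', Function.iterate_succ_apply', hα, hα]
      simp only
      rw [h1, h1, ih, mul_assoc]
  have hφ : φ ^ (Fintype.card T).factorial = 1 := by
    rw [← Fintype.card_perm]; exact pow_card_eq_one
  set N := (Fintype.card T).factorial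
  have h3 : ∀ l g, α^[N] (l, g) = (l, (α^[N] (l, 1)).2 * g) := by
    intro l g
    refine Prod.ext ?_ (h2 _ _ _)
    rw [h1, hφ]; rfl
  have h4 : ∀ n l g, (α^[N])^[n] (l, g) = (l, (α^[N] (l, 1)).2 ^ n * g) := by
    intro n
    induction n with
    | zero => intro l g; simp
    | succ n ih =>
      intro l g
      rw [Function.iterate_succ_apply', ih, h3, pow_succ', mul_assoc]
  rw [Function.iterate_mul]
  obtain ⟨l, g⟩ := y
  rw [h4, hm, one_mul]

theorem exists_perm_of_ker (f f' : T → T) (h : ∀ i j, f i = f j ↔ f' i = f' j) :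
    ∃ φ : Equiv.Perm T, ∀ j, f' j = φ (f j) := by
  classical
  have key : ∀ j, f' (⟨j, rfl⟩ : ∃ i, f i = f j).choose = f' j := fun j =>
    (h _ _).1 (⟨j, rfl⟩ : ∃ i, f i = f j).choose_spec
  let F : {t // ∃ i, f i = t} → {t // ∃ i, f' i = t} := fun t => ⟨f' t.2.choose, ⟨_, rfl⟩⟩
  have hF : Function.Bijective F := by
    constructor
    · rintro ⟨t, j, rfl⟩ ⟨s, i, rfl⟩ he
      have he : f' _ = f' _ := congrArg Subtype.val he
      simp only [key] at he
      exact Subtype.ext ((h _ _).2 he)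
    · rintro ⟨t, j, rfl⟩
      exact ⟨⟨f j, j, rfl⟩, Subtype.ext (key j)⟩
  refine ⟨(Equiv.ofBijective F hF).extendSubtype, fun j => ?_⟩
  rw [(Equiv.ofBijective F hF).extendSubtype_apply_of_mem (f j) ⟨j, rfl⟩]
  exact (key j).symm

end Jag

end NestedPebblesGraphs


namespace NestedPebblesGraphs

section Jag2

set_option linter.unusedSectionVars false

variable {S T G : Type} [Group G] [Fintype T] [DecidableEq T]

/-- Nested simulation: real run is the image of the virtual run as long as the coincidence
patterns agree. -/
theorem good_run (δ : S → (T → T → Prop) → S × (T → T) × (T → G)) (x : S × (T → G))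
    (v : S × (T → T × G)) (h : T → G) (hx : x = mapc (vint h) v) (r : ℕ)
    (hr : ∀ r' < r, ∀ i j, vint h (((jstep δ mvV)^[r'] v).2 i) = vint h (((jstep δ mvV)^[r'] v).2 j) →
      ((jstep δ mvV)^[r'] v).2 i = ((jstep δ mvV)^[r'] v).2 j) :
    (jstep δ mvR)^[r] x = mapc (vint h) ((jstep δ mvV)^[r] v) := by
  induction r with
  | zero => exact hx
  | succ r ih =>
    rw [Function.iterate_succ_apply', Function.iterate_succ_apply',
      ih (fun r' hr' => hr r' (by omega))]
    exact jstep_mapc δ (vint_mv h) (hr r (by omega))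

theorem merge_good (v : S × (T → T × G)) (h : T → G) (i j : T) (d : G)
    (hd : vint h (v.2 i) * d = vint h (v.2 j)) :
    mapc (vint h) (mapc (mergeMap v.2 i j d) v) = mapc (vint h) v := by
  simp only [mapc, merge_vint h v.2 i j d hd]

/-- Case where the virtual run comes back. -/
theorem loop_case (δ : S → (T → T → Prop) → S × (T → T) × (T → G)) (v w : S × (T → T × G))
    (h h' : T → G) (p m : ℕ) (hm : ∀ g : G, g ^ m = 1)
    (hw : (jstep δ mvV)^[p] v = w) (he : mapc (vint h) w = mapc (vint h') v)
    (hk : ∀ i j, (v.2 i).1 = (v.2 j).1 ↔ (w.2 i).1 = (w.2 j).1) :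
    (jstep δ mvV)^[p * ((Fintype.card T).factorial * m)] v = v := by
  obtain ⟨φ, hφ⟩ := exists_perm_of_ker (fun i => (v.2 i).1) (fun i => (w.2 i).1) hk
  let α : T × G → T × G := fun y => (φ y.1, ((h (φ y.1))⁻¹ * h' y.1) * y.2)
  have hα : ∀ y, α y = (φ y.1, (fun l => (h (φ l))⁻¹ * h' l) y.1 * y.2) := fun y => rfl
  have hinj : Function.Injective α := by
    rintro ⟨l, g⟩ ⟨l', g'⟩ e
    simp only [α, Prod.mk.injEq, EmbeddingLike.apply_eq_iff_eq] at e
    obtain ⟨rfl, e⟩ := e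
    simpa using e
  have hmv : ∀ d y, α (mvV d y) = mvV d (α y) := by
    intro d y
    simp only [α, mvV, mul_assoc]
  have hstep : ∀ n c, (jstep δ mvV)^[n] (mapc α c) = mapc α ((jstep δ mvV)^[n] c) := by
    intro n
    induction n with
    | zero => intro c; rfl
    | succ n ih =>
      intro c
      rw [Function.iterate_succ_apply', ih, Function.iterate_succ_apply',
        jstep_mapc δ hmv (fun i j e => hinj e)]
  have hwv : w = mapc α v := by
    have e1 := congrArg Prod.fst he
    have e2 := congrArg Prod.snd he
    refine Prod.ext e1 (funext fun j => ?_)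
    have e3 := congrFun e2 j
    simp only [mapc, vint] at e3
    refine Prod.ext (hφ j) ?_
    simp only [mapc, α]
    rw [← hφ j, mul_assoc, ← e3]
    simp
  have hit : ∀ n, (jstep δ mvV)^[p * n] v = mapc (α^[n]) v := by
    intro n
    induction n with
    | zero => rfl
    | succ n ih =>
      rw [Nat.mul_succ, Nat.add_comm, Function.iterate_add_apply, ih]
      have : ∀ k c, (jstep δ mvV)^[p] (mapc (α^[k]) c) = mapc (α^[k]) ((jstep δ mvV)^[p] c) := by
        intro k
        induction k with
        | zero => intro c; rfl
        | succ k ihk =>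
          intro c
          have e1 : ∀ c : S × (T → T × G), mapc (α^[k + 1]) c = mapc (α^[k]) (mapc α c) :=
            fun c => rfl
          rw [e1, ihk, hstep, e1]
      rw [this, hw, hwv]
      rfl
  rw [hit]
  have : α^[(Fintype.card T).factorial * m] = id :=
    funext fun y => alpha_iter φ (fun l => (h (φ l))⁻¹ * h' l) α hα m hm y
  rw [this]
  rfl

/-- Bound of the first kind. -/
def nB1 (B R : ℕ) : ℕ := R * (B + 1) + B
/-- Bound of the second kind. -/
def nE (t m B R : ℕ) : ℕ := nB1 B R * (t.factorial * m)
/-- New time bound. -/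
def nB (t m B R : ℕ) : ℕ := nB1 B R + nE t m B R
/-- New size bound. -/
def nR (t m B R : ℕ) : ℕ := (R * (nE t m B R + 1)) ^ 2 * t ^ 4

theorem claim_step (δ : S → (T → T → Prop) → S × (T → T) × (T → G)) (m : ℕ) (hm0 : 0 < m)
    (hm : ∀ g : G, g ^ m = 1) (c B R : ℕ) (hcl : Claim δ (c + 1) B R) :
    Claim δ c (nB (Fintype.card T) m B R) (nR (Fintype.card T) m B R) := by
  classical
  obtain ⟨W, hW, hcl⟩ := hcl
  set t := Fintype.card T with ht
  set E := nE t m B R with hE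
  let U : Finset (S × (T → T × G)) :=
    (W ×ˢ Finset.range (E + 1)).image (fun a => (jstep δ mvV)^[a.2] a.1)
  let M : (S × (T → T × G)) × (S × (T → T × G)) × T × T × T × T → S × (T → T × G) := fun a =>
    mapc (mergeMap a.1.2 a.2.2.1 a.2.2.2.1
      ((a.2.1.2 a.2.2.2.2.1).2⁻¹ * (a.2.1.2 a.2.2.2.2.2).2)) a.1
  have hU : ∀ v ∈ W, ∀ r ≤ E, (jstep δ mvV)^[r] v ∈ U := by
    intro v hv r hr
    refine Finset.mem_image.2 ⟨(v, r), ?_, rfl⟩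
    rw [Finset.mem_product]
    exact ⟨hv, Finset.mem_range.2 (by omega)⟩
  have hUc : U.card ≤ R * (E + 1) := by
    refine Finset.card_image_le.trans ?_
    rw [Finset.card_product, Finset.card_range]
    exact Nat.mul_le_mul_right _ hW
  let W' := (U ×ˢ U ×ˢ (Finset.univ : Finset (T × T × T × T))).image M
  have hW' : ∀ a ∈ U, ∀ b ∈ U, ∀ i j i' j',
      mapc (mergeMap a.2 i j ((b.2 i').2⁻¹ * (b.2 j').2)) a ∈ W' := by
    intro a ha b hb i j i' j'
    refine Finset.mem_image.2 ⟨(a, b, i, j, i', j'), ?_, rfl⟩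
    simp [ha, hb]
  refine ⟨W', ?_, ?_⟩
  · refine Finset.card_image_le.trans ?_
    rw [Finset.card_product, Finset.card_product, Finset.card_univ]
    simp only [Fintype.card_prod]
    rw [← ht]
    calc U.card * (U.card * (t * (t * (t * t)))) = U.card ^ 2 * t ^ 4 := by ring
      _ ≤ (R * (E + 1)) ^ 2 * t ^ 4 := Nat.mul_le_mul_right _ (Nat.pow_le_pow_left hUc 2)
  intro x
  by_contra hcon
  rw [not_or] at hcon
  obtain ⟨hrep, hnone⟩ := hcon
  have hnone' : ∀ s ≤ nB t m B R, ∀ v ∈ W', nl v ≤ c → ∀ h : T → G,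
      (jstep δ mvR)^[s] x ≠ mapc (vint h) v :=
    fun s hs v hv hc h e => hnone ⟨s, hs, v, hv, hc, h, e⟩
  have hrep' : ∀ i j, i < j → j ≤ nB t m B R →
      (jstep δ mvR)^[i] x ≠ (jstep δ mvR)^[j] x := fun i j h1 h2 e => hrep ⟨i, j, h1, h2, e⟩
  have hB1 : nB1 B R ≤ nB t m B R := Nat.le_add_right _ _
  -- visits
  have hvis : ∀ a : Fin (R + 1), ∃ s ≤ B, ∃ v ∈ W, nl v ≤ c + 1 ∧ ∃ h : T → G,
      (jstep δ mvR)^[s + a * (B + 1)] x = mapc (vint h) v := by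
    intro a
    have ha : (a : ℕ) * (B + 1) ≤ R * (B + 1) := Nat.mul_le_mul_right _ (by omega)
    rcases hcl ((jstep δ mvR)^[a * (B + 1)] x) with ⟨i, j, hij, hj, e⟩ | ⟨s, hs, v, hv, hc, h, e⟩
    · rw [← Function.iterate_add_apply, ← Function.iterate_add_apply] at e
      refine absurd e (hrep' _ _ (by omega) ?_)
      unfold nB1 at hB1
      omega
    · rw [← Function.iterate_add_apply] at e
      exact ⟨s, hs, v, hv, hc, h, e⟩
  choose s hs v hv hc h hx using hvis
  obtain ⟨a, b, hab, hvab⟩ : ∃ a b : Fin (R + 1), a < b ∧ v a = v b := by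
    obtain ⟨a, -, b, -, hne, e⟩ := Finset.exists_ne_map_eq_of_card_lt_of_maps_to
      (s := (Finset.univ : Finset (Fin (R + 1)))) (t := W) (f := v)
      (by simpa using Nat.lt_succ_of_le hW) (fun a _ => hv a)
    rcases lt_or_gt_of_ne hne with h | h
    · exact ⟨a, b, h, e⟩
    · exact ⟨b, a, h, e.symm⟩
  have hlt : s a + a * (B + 1) < s b + b * (B + 1) := by
    have h1 : ((a : ℕ) + 1) * (B + 1) ≤ b * (B + 1) := Nat.mul_le_mul_right _ hab
    have := hs a
    rw [Nat.add_mul] at h1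
    omega
  have hle : s b + b * (B + 1) ≤ nB1 B R := by
    have h1 : (b : ℕ) * (B + 1) ≤ R * (B + 1) := Nat.mul_le_mul_right _ (by omega)
    have := hs b
    unfold nB1
    omega
  have hxa := hx a
  have hxb := hx b
  have hva := hv a
  have hca := hc a
  rw [← hvab] at hxb
  generalize s a + a * (B + 1) = τ at hxa hlt
  generalize s b + b * (B + 1) = τ' at hxb hlt hle
  generalize v a = v at hxa hxb hva hca
  generalize h b = h' at hxb
  generalize h a = h at hxa
  obtain ⟨p, rfl⟩ : ∃ p, τ' = p + τ := ⟨τ' - τ, by omega⟩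
  have hp0 : 0 < p := by omega
  have he0 : 0 < t.factorial * m := Nat.mul_pos (Nat.factorial_pos _) hm0
  have hpE : p * (t.factorial * m) ≤ E := by
    rw [hE]; unfold nE
    exact Nat.mul_le_mul_right _ (by omega)
  have hp1 : p ≤ p * (t.factorial * m) := Nat.le_mul_of_pos_right _ he0
  have hnB : nB t m B R = nB1 B R + E := rfl
  by_cases hgood : ∀ r ≤ p * (t.factorial * m), ∀ i j,
      vint h (((jstep δ mvV)^[r] v).2 i) = vint h (((jstep δ mvV)^[r] v).2 j) →
      ((jstep δ mvV)^[r] v).2 i = ((jstep δ mvV)^[r] v).2 j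
  · have hrun : ∀ r ≤ p * (t.factorial * m),
        (jstep δ mvR)^[r + τ] x = mapc (vint h) ((jstep δ mvV)^[r] v) := by
      intro r hr
      rw [Function.iterate_add_apply]
      exact good_run δ _ v h hxa r (fun r' hr' => hgood r' (by omega))
    have hw := hrun p hp1
    set w := (jstep δ mvV)^[p] v with hwdef
    have hwU : w ∈ U := hU v hva p (by omega)
    have hvU : v ∈ U := hU v hva 0 (by omega)
    have hnlw : nl w ≤ c + 1 := (nl_iter _ _ _).trans hca
    have hww : mapc (vint h) w = mapc (vint h') v := hw.symm.trans hxb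
    have hjj : ∀ j, vint h (w.2 j) = vint h' (v.2 j) := fun j =>
      congrFun (congrArg Prod.snd hww) j
    by_cases hk : ∀ i j, (v.2 i).1 = (v.2 j).1 ↔ (w.2 i).1 = (w.2 j).1
    · have hloop := loop_case δ v w h h' p m hm hwdef.symm hww hk
      have h1 := hrun _ le_rfl
      rw [← ht] at hloop
      rw [hloop, ← hxa] at h1
      refine hrep' τ _ ?_ ?_ h1.symm
      · omega
      · omega
    · push Not at hk
      obtain ⟨i, j, hk⟩ := hk
      rcases hk with ⟨h1, h2⟩ | ⟨h1, h2⟩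
      · have hd : vint h (w.2 i) * ((v.2 i).2⁻¹ * (v.2 j).2) = vint h (w.2 j) := by
          rw [hjj, hjj]
          simp [vint, h1, mul_assoc]
        refine hnone' (p + τ) (by omega) _ (hW' w hwU v hvU i j i j) ?_ h ?_
        · have := merge_nl w i j ((v.2 i).2⁻¹ * (v.2 j).2) h2
          omega
        · rw [merge_good w h i j _ hd, hw]
      · have hd : vint h' (v.2 i) * ((w.2 i).2⁻¹ * (w.2 j).2) = vint h' (v.2 j) := by
          rw [← hjj, ← hjj]
          simp [vint, h2, mul_assoc]
        refine hnone' (p + τ) (by omega) _ (hW' v hvU w hwU i j i j) ?_ h' ?_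
        · have := merge_nl v i j ((w.2 i).2⁻¹ * (w.2 j).2) h1
          omega
        · rw [merge_good v h' i j _ hd, hxb]
  · push Not at hgood
    have hex : ∃ r, r ≤ p * (t.factorial * m) ∧ ∃ i j,
      vint h (((jstep δ mvV)^[r] v).2 i) = vint h (((jstep δ mvV)^[r] v).2 j) ∧
      ((jstep δ mvV)^[r] v).2 i ≠ ((jstep δ mvV)^[r] v).2 j := hgood
    obtain ⟨hr, i, j, h1, h2⟩ := Nat.find_spec hex
    have hmin := fun r' hr' => Nat.find_min hex (m := r') hr'
    generalize Nat.find hex = r at hr h1 h2 hmin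
    have hrun : (jstep δ mvR)^[r + τ] x = mapc (vint h) ((jstep δ mvV)^[r] v) := by
      rw [Function.iterate_add_apply]
      refine good_run δ _ v h hxa r (fun r' hr' i j e => ?_)
      by_contra hne
      exact hmin r' hr' ⟨by omega, i, j, e, hne⟩
    set w := (jstep δ mvV)^[r] v with hwdef
    have hwU : w ∈ U := hU v hva r (by omega)
    have hnlw : nl w ≤ c + 1 := (nl_iter _ _ _).trans hca
    have hd : vint h (w.2 i) * ((w.2 i).2⁻¹ * (w.2 i).2) = vint h (w.2 j) := by
      rw [inv_mul_cancel, mul_one, h1]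
    have hlab : (w.2 i).1 ≠ (w.2 j).1 := by
      intro e
      refine h2 (Prod.ext e ?_)
      simp only [vint, e] at h1
      exact mul_left_cancel h1
    refine hnone' (r + τ) (by omega) _ (hW' w hwU w hwU i j i i) ?_ h ?_
    · have := merge_nl w i j ((w.2 i).2⁻¹ * (w.2 i).2) hlab
      omega
    · rw [merge_good w h i j _ hd, hrun]

/-- Iterated bounds. -/
def bnd (t m s : ℕ) : ℕ → ℕ × ℕ
  | 0 => (0, s)
  | n + 1 => (nB t m (bnd t m s n).1 (bnd t m s n).2, nR t m (bnd t m s n).1 (bnd t m s n).2)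

theorem claim_iter [Fintype S] (δ : S → (T → T → Prop) → S × (T → T) × (T → G)) (m : ℕ) (hm0 : 0 < m)
    (hm : ∀ g : G, g ^ m = 1) (n c : ℕ) (hn : c + n = Fintype.card T) :
    Claim δ c (bnd (Fintype.card T) m (Fintype.card S) n).1
      (bnd (Fintype.card T) m (Fintype.card S) n).2 := by
  induction n generalizing c with
  | zero =>
    obtain rfl : c = Fintype.card T := by omega
    exact claim_base δ
  | succ n ih => exact claim_step δ m hm0 hm c _ _ (ih (c + 1) (by omega))

/-- Every orbit is short. -/
theorem orbit_short [Fintype S] [Nonempty T] (δ : S → (T → T → Prop) → S × (T → T) × (T → G)) (m : ℕ)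
    (hm0 : 0 < m) (hm : ∀ g : G, g ^ m = 1) (x : S × (T → G)) (n : ℕ) :
    ∃ i ≤ (bnd (Fintype.card T) m (Fintype.card S) (Fintype.card T)).1,
      (jstep δ mvR)^[n] x = (jstep δ mvR)^[i] x := by
  obtain ⟨W, -, hW⟩ := claim_iter δ m hm0 hm (Fintype.card T) 0 (by simp)
  generalize (bnd (Fintype.card T) m (Fintype.card S) (Fintype.card T)).1 = B at hW
  rcases hW x with ⟨i, j, hij, hj, e⟩ | ⟨s, _, v, _, h0, _⟩
  · induction n using Nat.strong_induction_on with
    | _ n ih =>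
      by_cases hn : n ≤ B
      · exact ⟨n, hn, rfl⟩
      · obtain ⟨l, hl, e'⟩ := ih (n - j + i) (by omega)
        refine ⟨l, hl, ?_⟩
        rw [← e']
        have h1 : n = (n - j) + j := by omega
        conv_lhs => rw [h1]
        rw [Function.iterate_add_apply, Function.iterate_add_apply, e]
  · exfalso
    have : 0 < nl v := Finset.card_pos.2 ⟨_, Finset.mem_image_of_mem _ (Finset.mem_univ (Classical.arbitrary T))⟩
    omega

/-- Polynomially bounded functions. -/
def PB (f : ℕ → ℕ) : Prop := ∃ C d, ∀ n, f n ≤ C * (n + 1) ^ d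

theorem PB.const (c : ℕ) : PB (fun _ => c) := ⟨c, 0, fun n => by simp⟩

theorem PB.id : PB (fun n => n) := ⟨1, 1, fun n => by simp⟩

theorem PB.mul {f g : ℕ → ℕ} (hf : PB f) (hg : PB g) : PB (fun n => f n * g n) := by
  obtain ⟨C, d, h⟩ := hf
  obtain ⟨C', d', h'⟩ := hg
  refine ⟨C * C', d + d', fun n => (Nat.mul_le_mul (h n) (h' n)).trans (le_of_eq ?_)⟩
  ring

theorem PB.add {f g : ℕ → ℕ} (hf : PB f) (hg : PB g) : PB (fun n => f n + g n) := by
  obtain ⟨C, d, h⟩ := hf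
  obtain ⟨C', d', h'⟩ := hg
  refine ⟨C + C', d + d', fun n => ?_⟩
  have h1 : (n + 1) ^ d ≤ (n + 1) ^ (d + d') := Nat.pow_le_pow_right (by omega) (by omega)
  have h2 : (n + 1) ^ d' ≤ (n + 1) ^ (d + d') := Nat.pow_le_pow_right (by omega) (by omega)
  have := Nat.mul_le_mul_left C h1
  have := Nat.mul_le_mul_left C' h2
  have := h n
  have := h' n
  rw [Nat.add_mul]
  change f n + g n ≤ _
  omega

theorem PB.pow {f : ℕ → ℕ} (hf : PB f) (k : ℕ) : PB (fun n => f n ^ k) := by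
  induction k with
  | zero => exact PB.const 1
  | succ k ih => exact ih.mul hf

theorem bnd_pb (t s n : ℕ) :
    PB (fun m => (bnd t m s n).1) ∧ PB (fun m => (bnd t m s n).2) := by
  induction n with
  | zero => exact ⟨PB.const 0, PB.const s⟩
  | succ n ih =>
    obtain ⟨h1, h2⟩ := ih
    have hB1 : PB (fun m => nB1 (bnd t m s n).1 (bnd t m s n).2) :=
      (h2.mul (h1.add (PB.const 1))).add h1
    have hE : PB (fun m => nE t m (bnd t m s n).1 (bnd t m s n).2) :=
      hB1.mul ((PB.const t.factorial).mul PB.id)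
    exact ⟨hB1.add hE, ((h2.mul (hE.add (PB.const 1))).pow 2).mul (PB.const (t ^ 4))⟩

theorem PB.lt_two_pow {f : ℕ → ℕ} (hf : PB f) : ∃ n, 1 ≤ n ∧ f (2 * n) < 2 ^ n := by
  obtain ⟨C, d, h⟩ := hf
  have h1 := tendsto_pow_const_div_const_pow_of_one_lt d (r := 2) (by norm_num)
  have hpos : (0 : ℝ) < 1 / (C * 3 ^ d + 1) := by positivity
  obtain ⟨n, hn, hn1⟩ := ((h1.eventually_lt_const hpos).and (Filter.eventually_ge_atTop 1)).exists
  refine ⟨n, hn1, ?_⟩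
  have h2 : f (2 * n) ≤ C * 3 ^ d * n ^ d := by
    refine (h _).trans ?_
    rw [mul_assoc, ← mul_pow]
    exact Nat.mul_le_mul_left _ (Nat.pow_le_pow_left (by omega) _)
  have h3 : ((C * 3 ^ d * n ^ d : ℕ) : ℝ) < (2 : ℝ) ^ n := by
    rw [div_lt_div_iff₀ (by positivity) (by positivity)] at hn
    push_cast
    have : (0 : ℝ) ≤ (n : ℝ) ^ d := by positivity
    nlinarith
  have h4 : C * 3 ^ d * n ^ d < 2 ^ n := by exact_mod_cast h3
  omega

end Jag2

end NestedPebblesGraphs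


namespace NestedPebblesGraphs

section Lamplighter

/-- The base group of the wreath product. -/
def wbase (D Q : Type) [Group D] [Group Q] : (Q → D) →* RegularWreathProduct D Q where
  toFun f := ⟨f, 1⟩
  map_one' := rfl
  map_mul' f f' := by
    apply RegularWreathProduct.ext
    · funext q
      simp
    · simp

theorem wreath_gen {D Q : Type} [Group D] [Group Q] [Finite Q] [DecidableEq Q] (d1 : D) (q1 : Q)
    (hD : ∀ d : D, d = 1 ∨ d = d1) (hQ : ∀ q : Q, ∃ n : ℕ, q = q1 ^ n) :
    Subgroup.closure {(RegularWreathProduct.inl q1 : RegularWreathProduct D Q),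
      wbase D Q (Pi.mulSingle 1 d1)} = ⊤ := by
  set s : RegularWreathProduct D Q := RegularWreathProduct.inl q1 with hsdef
  set t : RegularWreathProduct D Q := wbase D Q (Pi.mulSingle 1 d1) with htdef
  set H := Subgroup.closure {s, t} with hH
  have hs : s ∈ H := Subgroup.subset_closure (by simp)
  have ht : t ∈ H := Subgroup.subset_closure (by simp)
  have hq : ∀ q : Q, (RegularWreathProduct.inl q : RegularWreathProduct D Q) ∈ H := by
    intro q
    obtain ⟨n, rfl⟩ := hQ q
    rw [map_pow]
    exact H.pow_mem hs _
  have hb1 : ∀ q : Q, wbase D Q (Pi.mulSingle q d1) ∈ H := by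
    intro q
    have : wbase D Q (Pi.mulSingle q d1) =
        RegularWreathProduct.inl q * t * RegularWreathProduct.inl q⁻¹ := by
      apply RegularWreathProduct.ext
      · funext r
        by_cases hr : r = q
        · subst hr; simp [wbase, t]
        · have : q⁻¹ * r ≠ 1 := by
            intro h
            exact hr (inv_mul_eq_one.1 h).symm
          simp [wbase, t, Pi.mulSingle_eq_of_ne hr, Pi.mulSingle_eq_of_ne this]
      · simp [wbase, t]
    rw [this]
    exact H.mul_mem (H.mul_mem (hq q) ht) (hq _)
  have hb : ∀ (q : Q) (d : D), wbase D Q (Pi.mulSingle q d) ∈ H := by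
    intro q d
    rcases hD d with rfl | rfl
    · rw [Pi.mulSingle_one, map_one]; exact H.one_mem
    · exact hb1 q
  have hf : ∀ f : Q → D, wbase D Q f ∈ H := by
    intro f
    have : f ∈ H.comap (wbase D Q) :=
      Subgroup.pi_mem_of_mulSingle_mem f (fun q => hb q (f q))
    exact this
  rw [eq_top_iff]
  intro g _
  have : g = wbase D Q g.left * RegularWreathProduct.inl g.right := by
    apply RegularWreathProduct.ext
    · funext r
      simp [wbase]
    · simp [wbase]
  rw [this]
  exact H.mul_mem (hf _) (hq _)

theorem wreath_exp {D Q : Type} [Group D] [Group Q] (m n : ℕ) (hD : ∀ d : D, d ^ m = 1)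
    (hQ : ∀ q : Q, q ^ n = 1) (g : RegularWreathProduct D Q) : g ^ (m * n) = 1 := by
  have h1 : (g ^ n).right = 1 := by
    have : RegularWreathProduct.rightHom (g ^ n) = 1 := by
      rw [map_pow]; exact hQ _
    exact this
  have h2 : g ^ n = wbase D Q (g ^ n).left := by
    apply RegularWreathProduct.ext
    · rfl
    · exact h1
  rw [mul_comm, pow_mul, h2, ← map_pow]
  have : (g ^ n).left ^ m = 1 := by
    funext q
    rw [Pi.pow_apply]; exact hD _
  rw [this, map_one]

theorem lamplighter (n : ℕ) (hn : 1 ≤ n) :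
    ∃ (G : Type) (_ : Group G) (_ : Fintype G) (s t : G), Subgroup.closure {s, t} = ⊤ ∧
      (∀ g : G, g ^ (2 * n) = 1) ∧ 2 ^ n ≤ Fintype.card G := by
  classical
  have : NeZero n := ⟨by omega⟩
  let ff : Fintype (RegularWreathProduct (Multiplicative (ZMod 2)) (Multiplicative (ZMod n))) :=
    Fintype.ofFinite _
  refine ⟨RegularWreathProduct (Multiplicative (ZMod 2)) (Multiplicative (ZMod n)), inferInstance,
    ff, _, _,
    wreath_gen (Multiplicative.ofAdd 1) (Multiplicative.ofAdd 1) ?_ ?_,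
    wreath_exp 2 n ?_ ?_, ?_⟩
  · have : ∀ z : ZMod 2, z = 0 ∨ z = 1 := by decide
    exact fun d => this (Multiplicative.toAdd d)
  · intro q
    refine ⟨(Multiplicative.toAdd q).val, ?_⟩
    apply Multiplicative.toAdd.injective
    rw [toAdd_pow]
    simp
  · have : ∀ z : ZMod 2, 2 • z = 0 := by decide
    exact fun d => this (Multiplicative.toAdd d)
  · intro q
    apply Multiplicative.toAdd.injective
    rw [toAdd_pow]
    simp
  · rw [← Nat.card_eq_fintype_card, RegularWreathProduct.card]
    simp only [Nat.card_eq_fintype_card, Fintype.card_multiplicative, ZMod.card]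
    exact Nat.le_mul_of_pos_right _ hn

end Lamplighter

section Cayley

variable {Sig : Type} {G : Type} [Group G] [Fintype G]

/-- Cayley graph of a two-generated group. -/
def cayley (z o : Sig) (hzo : z ≠ o) (s t : G) (hst : Subgroup.closure {s, t} = ⊤) (lab : G → Sig) :
    LGraph Sig where
  V := G
  finV := inferInstance
  neV := ⟨1⟩
  nlab := lab
  edge := fun a u v => (a = z ∧ v = u * s) ∨ (a = o ∧ v = u * t)
  out_unique := by
    rintro a u v v' (⟨rfl, rfl⟩ | ⟨rfl, rfl⟩) (⟨h, rfl⟩ | ⟨h, rfl⟩)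
    · rfl
    · exact absurd h hzo
    · exact absurd h.symm hzo
    · rfl
  in_unique := by
    rintro a u v v' (⟨rfl, rfl⟩ | ⟨rfl, rfl⟩) (⟨h, h'⟩ | ⟨h, h'⟩)
    · exact mul_right_cancel h'
    · exact absurd h hzo
    · exact absurd h.symm hzo
    · exact mul_right_cancel h'
  conn := by
    intro u v
    have key : ∀ g ∈ Subgroup.closure {s, t}, ∀ u : G,
        Relation.ReflTransGen (fun x y => (∃ a, (a = z ∧ y = x * s) ∨ (a = o ∧ y = x * t)) ∨
          (∃ a, (a = z ∧ x = y * s) ∨ (a = o ∧ x = y * t))) u (u * g) := by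
      intro g hg
      induction hg using Subgroup.closure_induction with
      | mem x hx =>
        intro u
        rcases hx with rfl | rfl
        · exact .single (.inl ⟨z, .inl ⟨rfl, rfl⟩⟩)
        · exact .single (.inl ⟨o, .inr ⟨rfl, rfl⟩⟩)
      | one => intro u; rw [mul_one]
      | mul x y _ _ hx hy =>
        intro u
        rw [← mul_assoc]
        exact (hx u).trans (hy _)
      | inv x _ hx =>
        intro u
        have h := hx (u * x⁻¹)
        rw [inv_mul_cancel_right] at h
        have hsym : Std.Symm (fun x y => (∃ a, (a = z ∧ y = x * s) ∨ (a = o ∧ y = x * t)) ∨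
          (∃ a, (a = z ∧ x = y * s) ∨ (a = o ∧ x = y * t))) := ⟨fun a b h => h.symm⟩
        exact Relation.ReflTransGen.stdSymm.symm _ _ h
    have := key (u⁻¹ * v) (by rw [hst]; trivial) u
    simpa using this

end Cayley

end NestedPebblesGraphs


namespace NestedPebblesGraphs

section Simulation

set_option linter.unusedSectionVars false

variable {Sig : Type} {G : Type} [Group G] [Fintype G] {k : ℕ}

/-- Effect of an instruction on the names in the stack. -/
def effl {X : Type} : GInstr Sig k X → List X → List X
  | .dropPeb _ x, l => x :: l
  | .retrieve _, l => l.tail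
  | _, l => l

open Classical in
/-- Effect of an instruction: where tokens jump. -/
noncomputable def efft {X : Type} : GInstr Sig k X → Fin k ⊕ X → Fin k ⊕ X
  | .dropPeb i x, j => if j = .inr x then .inl i else j
  | .jump i x, j => if j = .inl i then .inr x else j
  | _, j => j

open Classical in
/-- Effect of an instruction: how tokens move. -/
noncomputable def effg {X : Type} (z : Sig) (s t : G) : GInstr Sig k X → Fin k ⊕ X → G
  | .inmove i a, j => if j = .inl i then (if a = z then s else t)⁻¹ else 1
  | .outmove i a, j => if j = .inl i then (if a = z then s else t) else 1
  | _, _ => 1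

/-- Truth of a test in a Cayley graph. -/
def thold {X : Type} (z o : Sig) (l : List X) (ker : Fin k ⊕ X → Fin k ⊕ X → Prop) :
    GTest Sig k X → Prop
  | .lab _ a => z = a
  | .inedge _ a => a = z ∨ a = o
  | .outedge _ a => a = z ∨ a = o
  | .peb i x => x ∈ l ∧ ker (.inl i) (.inr x)

/-- Approximation of being executable. -/
def ena {X : Type} (z o : Sig) (l : List X) (ker : Fin k ⊕ X → Fin k ⊕ X → Prop) :
    GInstr Sig k X → Prop
  | .dropPeb _ x => x ∉ l
  | .test b τ => thold z o l ker τ ↔ b = true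
  | _ => True

theorem effl_nodup {X : Type} (z o : Sig) (l : List X) (ker : Fin k ⊕ X → Fin k ⊕ X → Prop)
    (ins : GInstr Sig k X) (h : ena z o l ker ins) (hl : l.Nodup) : (effl ins l).Nodup := by
  cases ins with
  | dropPeb i x => exact List.nodup_cons.2 ⟨h, hl⟩
  | retrieve x => exact hl.tail
  | inmove i a => exact hl
  | outmove i a => exact hl
  | jump i a => exact hl
  | test i a => exact hl

open Classical in
/-- The abstract automaton simulating `A`. -/
noncomputable def simδ (A : GWA Sig k) (z o : Sig) (s t : G)
    (q : A.Q × {l : List A.X // l.Nodup}) (ker : Fin k ⊕ A.X → Fin k ⊕ A.X → Prop) :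
    (A.Q × {l : List A.X // l.Nodup}) × (Fin k ⊕ A.X → Fin k ⊕ A.X) × (Fin k ⊕ A.X → G) :=
  if h : ∃ t ∈ A.instr, t.1 = q.1 ∧ ena z o q.2.1 ker t.2.1 then
    ((h.choose.2.2, ⟨effl h.choose.2.1 q.2.1,
      effl_nodup z o q.2.1 ker _ h.choose_spec.2.2 q.2.2⟩), efft h.choose.2.1,
      effg z s t h.choose.2.1)
  else (q, id, fun _ => 1)

variable (z o : Sig) (hzo : z ≠ o) (s t : G) (hst : Subgroup.closure {s, t} = ⊤)

theorem instr_sim {X : Type} (ins : GInstr Sig k X) (y : Fin k ⊕ X → G) (l : List X)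
    (hl : l.Nodup) (hs' : Fin k → G) (σ' : List (X × G))
    (h : gInstrStep (cayley z o hzo s t hst (fun _ => z)) ins (fun i => y (.inl i))
      (stk l (fun x => y (.inr x))) hs' σ') :
    ena z o l (fun i j => y i = y j) ins ∧
    (hs' = fun i => y (efft ins (.inl i)) * effg z s t ins (.inl i)) ∧
    σ' = stk (effl ins l) (fun x => y (efft ins (.inr x)) * effg z s t ins (.inr x)) := by
  classical
  cases ins with
  | inmove i a =>
    obtain ⟨h1, h2, h3⟩ := h
    refine ⟨trivial, ?_, ?_⟩
    · funext j
      by_cases hj : j = i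
      · subst hj
        rcases h2 with ⟨rfl, h2⟩ | ⟨rfl, h2⟩
        · simp only [efft, effg, if_true]
          exact eq_mul_inv_of_mul_eq h2.symm
        · simp only [efft, effg, if_true, if_neg (Ne.symm hzo)]
          exact eq_mul_inv_of_mul_eq h2.symm
      · have := h3 j hj
        simp [efft, effg, hj, this]
    · have h5 : σ' = stk l (fun x => y (.inr x)) := h1
      rw [h5]
      simp [efft, effg, effl]
  | outmove i a =>
    obtain ⟨h1, h2, h3⟩ := h
    refine ⟨trivial, ?_, ?_⟩
    · funext j
      by_cases hj : j = i
      · subst hj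
        rcases h2 with ⟨rfl, h2⟩ | ⟨rfl, h2⟩
        · simp only [efft, effg, if_true]
          exact h2
        · simp only [efft, effg, if_true, if_neg (Ne.symm hzo)]
          exact h2
      · have := h3 j hj
        simp [efft, effg, hj, this]
    · have h5 : σ' = stk l (fun x => y (.inr x)) := h1
      rw [h5]
      simp [efft, effg, effl]
  | dropPeb i x =>
    obtain ⟨h1, h2, h3⟩ := h
    have hx : x ∉ l := fun hl => h3 (y (.inr x)) ((mem_stk _ _ _ _).2 ⟨hl, rfl⟩)
    refine ⟨hx, ?_, ?_⟩
    · rw [h1]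
      simp [efft, effg]
    · have h5 : σ' = (x, y (.inl i)) :: stk l (fun x => y (.inr x)) := h2
      rw [h5]
      simp only [effl, stk, List.map_cons, efft, effg, mul_one, if_true]
      congr 1
      apply List.map_congr_left
      intro x' hx'
      have : x' ≠ x := by rintro rfl; exact hx hx'
      simp [this]
  | retrieve x =>
    obtain ⟨h1, w, h2⟩ := h
    refine ⟨trivial, ?_, ?_⟩
    · rw [h1]
      simp [efft, effg]
    · simp only [effl, efft, effg, mul_one]
      cases l with
      | nil => simp [stk] at h2
      | cons x' l =>
        have h5 : (x', y (.inr x')) :: stk l (fun x => y (.inr x)) =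
          ((x, w) : X × G) :: σ' := h2
        exact (List.cons.inj h5).2.symm
  | jump i x =>
    obtain ⟨h1, h2, h3⟩ := h
    refine ⟨trivial, ?_, ?_⟩
    · funext j
      by_cases hj : j = i
      · subst hj
        have h5 : hs' j = y (.inr x) := ((mem_stk l (fun x => y (.inr x)) x (hs' j)).1 h2).2
        simp [efft, effg, h5]
      · have := h3 j hj
        simp [efft, effg, hj, this]
    · have h5 : σ' = stk l (fun x => y (.inr x)) := h1
      rw [h5]
      simp [efft, effg, effl]
  | test b τ =>
    obtain ⟨h1, h2, h3⟩ := h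
    refine ⟨?_, ?_, ?_⟩
    · refine Iff.trans ?_ h3
      cases τ with
      | lab i a => exact Iff.rfl
      | inedge i a =>
        constructor
        · rintro (rfl | rfl)
          · exact ⟨y (.inl i) * s⁻¹, .inl ⟨rfl, by simp⟩⟩
          · exact ⟨y (.inl i) * t⁻¹, .inr ⟨rfl, by simp⟩⟩
        · rintro ⟨u, ⟨h, _⟩ | ⟨h, _⟩⟩
          · exact .inl h
          · exact .inr h
      | outedge i a =>
        constructor
        · rintro (rfl | rfl)
          · exact ⟨_, .inl ⟨rfl, rfl⟩⟩
          · exact ⟨_, .inr ⟨rfl, rfl⟩⟩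
        · rintro ⟨u, ⟨h, _⟩ | ⟨h, _⟩⟩
          · exact .inl h
          · exact .inr h
      | peb i x => exact (mem_stk l (fun x => y (.inr x)) x (y (.inl i))).symm
    · rw [h1]
      simp [efft, effg]
    · have h5 : σ' = stk l (fun x => y (.inr x)) := h2
      rw [h5]
      simp [efft, effg, effl]

/-- Simulation relation. -/
def Sim (A : GWA Sig k) (c : A.Q × (Fin k → G) × List (A.X × G))
    (v : (A.Q × {l : List A.X // l.Nodup}) × (Fin k ⊕ A.X → G)) : Prop :=
  c.1 = v.1.1 ∧ (c.2.1 = fun i => v.2 (.inl i)) ∧ c.2.2 = stk v.1.2.1 (fun x => v.2 (.inr x))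

theorem sim_step {A : GWA Sig k} (hA : GDeterministic A)
    (c c' : A.Q × (Fin k → G) × List (A.X × G))
    (v : (A.Q × {l : List A.X // l.Nodup}) × (Fin k ⊕ A.X → G)) (hv : Sim A c v)
    (h : GStep A (cayley z o hzo s t hst (fun _ => z)) c c') :
    Sim A c' (jstep (simδ A z o s t) mvR v) := by
  obtain ⟨p, a, σ⟩ := c
  obtain ⟨p', a', σ'⟩ := c'
  obtain ⟨⟨q, l, hl⟩, y⟩ := v
  obtain ⟨h1, h2, h3⟩ := hv
  simp only at h1 h2 h3
  subst h1 h2 h3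
  obtain ⟨ins, ht, hi⟩ := h
  simp only at ht hi
  obtain ⟨e1, e2, e3⟩ := instr_sim z o hzo s t hst ins y l hl a' σ' hi
  have hex : ∃ t ∈ A.instr, t.1 = p ∧ ena z o l (fun i j => y i = y j) t.2.1 :=
    ⟨_, ht, rfl, e1⟩
  have hch : hex.choose = (p, ins, p') := by
    obtain ⟨c1, c2, c3⟩ := hex.choose_spec
    generalize hex.choose = tt at c1 c2 c3
    obtain ⟨p1, ins1, p1'⟩ := tt
    simp only at c2 c3
    subst c2
    by_contra hne
    have hne' : (ins1, p1') ≠ (ins, p') := by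
      intro e
      simp only [Prod.mk.injEq] at e
      obtain ⟨rfl, rfl⟩ := e
      exact hne rfl
    rcases hA _ _ _ _ _ c1 ht hne' with ⟨b, τ, rfl, rfl⟩ | ⟨b, τ, rfl, rfl⟩ <;>
    · simp only [ena] at c3 e1
      rw [c3] at e1
      cases b <;> simp at e1
  have hδ : simδ A z o s t (p, ⟨l, hl⟩) (fun i j => y i = y j) =
      ((p', ⟨effl ins l, effl_nodup z o l (fun i j => y i = y j) ins e1 hl⟩), efft ins, effg z s t ins) := by
    unfold simδ
    rw [dif_pos hex]
    simp only [hch]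
  unfold jstep
  simp only [hδ]
  exact ⟨rfl, e2, e3⟩

theorem sim_run {A : GWA Sig k} (hA : GDeterministic A)
    (c c' : A.Q × (Fin k → G) × List (A.X × G))
    (v : (A.Q × {l : List A.X // l.Nodup}) × (Fin k ⊕ A.X → G)) (hv : Sim A c v)
    (h : Relation.ReflTransGen (GStep A (cayley z o hzo s t hst (fun _ => z))) c c') :
    ∃ n, Sim A c' ((jstep (simδ A z o s t) mvR)^[n] v) := by
  induction h with
  | refl => exact ⟨0, hv⟩
  | tail _ h ih =>
    obtain ⟨n, hn⟩ := ih
    refine ⟨n + 1, ?_⟩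
    rw [Function.iterate_succ_apply']
    exact sim_step z o hzo s t hst hA _ _ _ hn h

theorem instr_relabel {X : Type} (f f' : G → Sig) (ins : GInstr Sig k X) (a a' : Fin k → G)
    (σ σ' : List (X × G)) (hf : ∀ i, f (a i) = f' (a i)) :
    gInstrStep (cayley z o hzo s t hst f) ins a σ a' σ' ↔
    gInstrStep (cayley z o hzo s t hst f') ins a σ a' σ' := by
  cases ins with
  | test b τ =>
    cases τ with
    | lab i c =>
      have : gTestHolds (cayley z o hzo s t hst f) (.lab i c) a σ ↔
          gTestHolds (cayley z o hzo s t hst f') (.lab i c) a σ := by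
        change f (a i) = c ↔ f' (a i) = c
        rw [hf]
      change _ ∧ _ ∧ _ ↔ _ ∧ _ ∧ _
      rw [this]
      exact Iff.rfl
    | inedge i c => exact Iff.rfl
    | outedge i c => exact Iff.rfl
    | peb i x => exact Iff.rfl
  | _ => exact Iff.rfl

theorem step_relabel (A : GWA Sig k) (f f' : G → Sig)
    (c c' : A.Q × (Fin k → G) × List (A.X × G)) (hf : ∀ i, f (c.2.1 i) = f' (c.2.1 i)) :
    GStep A (cayley z o hzo s t hst f) c c' ↔ GStep A (cayley z o hzo s t hst f') c c' :=
  exists_congr fun ins => and_congr Iff.rfl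
    (instr_relabel z o hzo s t hst f f' ins c.2.1 c'.2.1 c.2.2 c'.2.2 hf)

end Simulation

theorem allz_not_mem (Sig : Type) (z o : Sig) (hzo : z ≠ o) (k : ℕ) (hk : 1 ≤ k) :
    {g : LGraph Sig | ∀ v : g.V, g.nlab v = z} ∉ DPTWAgJ Sig Set.univ k := by
  classical
  rintro ⟨A, hA, hI, hL⟩
  have hmem : ∀ g : LGraph Sig, (∀ v : g.V, g.nlab v = z) ↔ GAccepts A g := by
    intro g
    have := Set.ext_iff.1 hL g
    simpa using this
  have := A.finQ
  have := A.finX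
  let T := Fin k ⊕ A.X
  let S := A.Q × {l : List A.X // l.Nodup}
  have : Nonempty (Fin k ⊕ A.X) := ⟨.inl ⟨0, hk⟩⟩
  have hpb := (bnd_pb (Fintype.card (Fin k ⊕ A.X))
    (Fintype.card (A.Q × {l : List A.X // l.Nodup})) (Fintype.card (Fin k ⊕ A.X))).1
  obtain ⟨n, hn1, hn⟩ := (((hpb.add (PB.const 1)).mul
    (PB.const (Fintype.card (Fin k ⊕ A.X))))).lt_two_pow
  obtain ⟨G, _, _, s, t, hst, hexp, hcard⟩ := lamplighter n hn1
  let x0 : (A.Q × {l : List A.X // l.Nodup}) × (Fin k ⊕ A.X → G) :=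
    ((A.q0, ⟨[], List.nodup_nil⟩), fun _ => 1)
  have horb := orbit_short (simδ A z o s t) (2 * n) (by omega) hexp x0
  set B := (bnd (Fintype.card (Fin k ⊕ A.X)) (2 * n)
    (Fintype.card (A.Q × {l : List A.X // l.Nodup})) (Fintype.card (Fin k ⊕ A.X))).1
  -- an unvisited node
  obtain ⟨v0, hv0⟩ : ∃ v0 : G, ∀ n j, ((jstep (simδ A z o s t) mvR)^[n] x0).2 j ≠ v0 := by
    let vis : Finset G := (Finset.univ : Finset (Fin (B + 1) × (Fin k ⊕ A.X))).image
      (fun a => ((jstep (simδ A z o s t) mvR)^[(a.1 : ℕ)] x0).2 a.2)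
    have hc : vis.card < Fintype.card G := by
      refine lt_of_le_of_lt Finset.card_image_le (lt_of_lt_of_le ?_ hcard)
      rw [Finset.card_univ, Fintype.card_prod, Fintype.card_fin]
      exact hn
    obtain ⟨v0, hv0⟩ : ∃ v0, v0 ∉ vis := by
      by_contra hall
      push Not at hall
      rw [Finset.eq_univ_of_forall hall, Finset.card_univ] at hc
      exact lt_irrefl _ hc
    refine ⟨v0, fun n j e => hv0 ?_⟩
    obtain ⟨i, hi, e'⟩ := horb n
    rw [e'] at e
    exact Finset.mem_image.2 ⟨(⟨i, by omega⟩, j), Finset.mem_univ _, e⟩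
  let f' : G → Sig := fun u => if u = v0 then o else z
  have hacc : GAccepts A (cayley z o hzo s t hst (fun _ => z)) := (hmem _).1 (fun _ => rfl)
  obtain ⟨q, hs, hq, hrun, hhalt⟩ := hacc (1 : G)
  have hsim0 : Sim A (A.q0, fun _ => (1 : G), []) x0 := ⟨rfl, rfl, rfl⟩
  have hav : ∀ c : A.Q × (Fin k → G) × List (A.X × G),
      Relation.ReflTransGen (GStep A (cayley z o hzo s t hst (fun _ => z)))
        (A.q0, fun _ => (1 : G), []) c → ∀ i, z = f' (c.2.1 i) := by
    intro c hc i
    obtain ⟨m, hm⟩ := sim_run z o hzo s t hst hA _ _ _ hsim0 hc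
    have := hv0 m (.inl i)
    rw [hm.2.1]
    exact (if_neg this).symm
  have hrun' : ∀ c : A.Q × (Fin k → G) × List (A.X × G),
      Relation.ReflTransGen (GStep A (cayley z o hzo s t hst (fun _ => z)))
        (A.q0, fun _ => (1 : G), []) c →
      Relation.ReflTransGen (GStep A (cayley z o hzo s t hst f'))
        (A.q0, fun _ => (1 : G), []) c := by
    intro c hc
    induction hc with
    | refl => exact .refl
    | @tail c c' hc hstep ih =>
      exact ih.tail ((step_relabel z o hzo s t hst A (fun _ => z) f' c c' (hav c hc)).1 hstep)
  have hacc' : AccFrom A (cayley z o hzo s t hst f') (1 : G) := by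
    refine ⟨q, hs, hq, hrun' _ hrun, fun c' hc' => hhalt c' ?_⟩
    exact (step_relabel z o hzo s t hst A (fun _ => z) f' (q, hs, []) c' (hav _ hrun)).2 hc'
  have hall : GAccepts A (cayley z o hzo s t hst f') := fun u => hI _ _ u hacc'
  have := (hmem _).2 hall v0
  have hv : f' v0 = o := if_pos rfl
  exact hzo (this.symm.trans hv)

theorem DPTWAgJ_ssubset_FODTCg_univ (Sig : Type) [Fintype Sig]
    (z o : Sig) (hzo : z ≠ o) (k : ℕ) (hk : 1 ≤ k) :
    (∃ φ : GForm Sig k, GTCFree φ ∧ GWF φ ∧ gfree φ = ∅ ∧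
      {g : LGraph Sig | ∀ v : g.V, g.nlab v = z} =
        {g | ∀ ν : ℕ → g.V, GSat g φ ν}) ∧
    {g : LGraph Sig | ∀ v : g.V, g.nlab v = z} ∈ FODTCg Sig Set.univ k ∧
    {g : LGraph Sig | ∀ v : g.V, g.nlab v = z} ∉ DPTWAgJ Sig Set.univ k ∧
    DPTWAgJ Sig Set.univ k ⊂ FODTCg Sig Set.univ k ∧
    {L | ∃ k', 1 ≤ k' ∧ L ∈ DPTWAgJ Sig Set.univ k'} ⊂
      {L | ∃ k', 1 ≤ k' ∧ L ∈ FODTCg Sig Set.univ k'} := by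
  refine ⟨allz_spec Sig z k, allz_mem Sig z k, allz_not_mem Sig z o hzo k hk,
    ⟨DPTWAgJ_subset_FODTCg Sig k, fun h => allz_not_mem Sig z o hzo k hk (h (allz_mem Sig z k))⟩,
    ?_, ?_⟩
  · rintro L ⟨k', hk', hL⟩
    exact ⟨k', hk', DPTWAgJ_subset_FODTCg Sig k' hL⟩
  · intro h
    obtain ⟨k', hk', hL⟩ := h ⟨k, hk, allz_mem Sig z k⟩
    exact allz_not_mem Sig z o hzo k' hk' hL

end NestedPebblesGraphs
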